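/- arXiv:2411.00060 — 11 statements merged into one kernel-verified Lean document; each statement's English description precedes it below -/
import Mathlib

section
/- For every real number β with 0 < |β| < 1, every real number α with 0 < |α| < π, and every x > 0, the integral ∫₀^∞ y^β / (x² + y² + 2xy·cos α) dy converges and equals x^{β−1} · π·sin(βα) / (sin α · sin(βπ)). -/
open MeasureTheory Real

lemma aux_base (s : ℝ) (hs0 : 0 < s) (hs1 : s < 1) :
    IntegrableOn (fun y : ℝ => ((y ^ (s - 1) / (1 + y) : ℝ) : ℂ)) (Set.Ioi 0) ∧
    ∫ y in Set.Ioi (0:ℝ), ((y ^ (s - 1) / (1 + y) : ℝ) : ℂ) = π / Complex.sin (π * s) := by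
  set g : ℝ → ℂ := fun x => (x : ℂ) ^ ((s:ℂ) - 1) * (1 - (x : ℂ)) ^ ((1 - s : ℂ) - 1) with hg
  have hre : 0 < (s : ℂ).re := by simpa using hs0
  have hre' : 0 < (1 - (s : ℂ)).re := by simpa using hs1
  have him : (fun y : ℝ => y / (1 + y)) '' Set.Ioi 0 = Set.Ioo 0 1 := by
    ext u
    simp only [Set.mem_image, Set.mem_Ioi, Set.mem_Ioo]
    constructor
    · rintro ⟨y, hy, rfl⟩
      exact ⟨by positivity, by rw [div_lt_one (by positivity)]; linarith⟩
    · rintro ⟨h0, h1⟩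
      have : 1 - u ≠ 0 := by linarith
      refine ⟨u / (1 - u), div_pos h0 (by linarith), ?_⟩
      field_simp
      ring
  have hd : ∀ y ∈ Set.Ioi (0:ℝ), HasDerivWithinAt (fun y : ℝ => y / (1 + y)) (1 / (1 + y) ^ 2)
      (Set.Ioi 0) y := by
    intro y hy
    have hy' : (1 + y) ≠ 0 := by have : 0 < y := hy; positivity
    have := (hasDerivAt_id y).div ((hasDerivAt_id y).const_add 1) hy'
    refine HasDerivAt.hasDerivWithinAt ?_
    convert! this using 1
    simp
  have hinj : Set.InjOn (fun y : ℝ => y / (1 + y)) (Set.Ioi 0) := by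
    intro a ha b hb hab
    have ha' : (1 + a) ≠ 0 := by have : 0 < a := ha; positivity
    have hb' : (1 + b) ≠ 0 := by have : 0 < b := hb; positivity
    simp only at hab
    rw [div_eq_div_iff ha' hb'] at hab
    linarith
  have hcongr : ∀ y ∈ Set.Ioi (0:ℝ), |1 / (1 + y) ^ 2| • g (y / (1 + y)) =
      ((y ^ (s - 1) / (1 + y) : ℝ) : ℂ) := by
    intro y hy
    have hy0 : 0 < y := hy
    have h1 : 0 < 1 + y := by positivity
    have e1 : (1 : ℂ) - ((y / (1 + y) : ℝ) : ℂ) = (((1 + y)⁻¹ : ℝ) : ℂ) := by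
      rw [← Complex.ofReal_one, ← Complex.ofReal_sub]
      congr 1
      field_simp
      ring
    simp only [hg]
    rw [e1, abs_of_pos (by positivity)]
    have e2 : ((s : ℂ) - 1) = ((s - 1 : ℝ) : ℂ) := by push_cast; ring
    have e3 : ((1 - s : ℂ) - 1) = ((-s : ℝ) : ℂ) := by push_cast; ring
    rw [e2, e3, ← Complex.ofReal_cpow (by positivity), ← Complex.ofReal_cpow (by positivity),
      ← Complex.ofReal_mul, Complex.real_smul, ← Complex.ofReal_mul]
    congr 1
    rw [Real.div_rpow hy0.le h1.le, Real.inv_rpow h1.le, Real.rpow_neg h1.le, inv_inv,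
      Real.rpow_sub h1, Real.rpow_one]
    have : (1 + y) ^ s ≠ 0 := (Real.rpow_pos_of_pos h1 s).ne'
    field_simp
  constructor
  · have h := Complex.betaIntegral_convergent hre hre'
    rw [intervalIntegrable_iff_integrableOn_Ioo_of_le zero_le_one, ← him,
      integrableOn_image_iff_integrableOn_abs_deriv_smul measurableSet_Ioi hd hinj] at h
    exact h.congr_fun hcongr measurableSet_Ioi
  · rw [← setIntegral_congr_fun measurableSet_Ioi hcongr,
      ← integral_image_eq_integral_abs_deriv_smul measurableSet_Ioi hd hinj, him,
      ← integral_Ioc_eq_integral_Ioo, ← intervalIntegral.integral_of_le zero_le_one]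
    have h2 := Complex.Gamma_mul_Gamma_eq_betaIntegral hre hre'
    rw [add_sub_cancel, Complex.Gamma_one, one_mul, Complex.Gamma_mul_Gamma_one_sub] at h2
    rw [h2]; rfl

lemma aux_lower (z : ℂ) (hz : z ∈ Complex.slitPlane) :
    ∃ c > 0, ∀ y : ℝ, 0 < y → c * (1 + y) ≤ ‖(y : ℂ) + z‖ := by
  have hz0 : z ≠ 0 := Complex.slitPlane_ne_zero hz
  have hn : 0 < ‖z‖ := norm_pos_iff.2 hz0
  have hk : 0 < ‖z‖ + z.re := by
    rcases Complex.mem_slitPlane_iff.1 hz with h | h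
    · linarith
    · have := Complex.abs_re_lt_norm.2 h
      linarith [neg_abs_le z.re]
  have hsq : ‖z‖ ^ 2 = z.re ^ 2 + z.im ^ 2 := by
    rw [Complex.sq_norm, Complex.normSq_apply]; ring
  have hre := Complex.re_le_norm z
  -- `|y+z|² ≥ (‖z‖ + re z)/(2‖z‖) (y+‖z‖)²`
  set m := (‖z‖ + z.re) / (2 * ‖z‖) with hm
  have hm0 : 0 < m := by positivity
  have hkey : ∀ y : ℝ, 0 < y → m * (y + ‖z‖) ^ 2 ≤ ‖(y : ℂ) + z‖ ^ 2 := by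
    intro y hy
    rw [Complex.sq_norm, Complex.normSq_apply]
    simp only [Complex.add_re, Complex.ofReal_re, Complex.add_im, Complex.ofReal_im, zero_add]
    rw [hm, div_mul_eq_mul_div, div_le_iff₀ (by positivity)]
    have : ((y + z.re) * (y + z.re) + z.im * z.im) = y ^ 2 + 2 * y * z.re + ‖z‖ ^ 2 := by
      rw [hsq]; ring
    rw [this]
    nlinarith [mul_nonneg (sub_nonneg.2 hre) (sq_nonneg (y - ‖z‖))]
  refine ⟨√m * min 1 ‖z‖, by positivity, fun y hy => ?_⟩
  have h1 : √m * min 1 ‖z‖ * (1 + y) ≤ √m * (y + ‖z‖) := by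
    rw [mul_assoc]
    gcongr
    have := min_le_left 1 ‖z‖
    have := min_le_right 1 ‖z‖
    nlinarith
  refine h1.trans ?_
  apply le_of_sq_le_sq _ (norm_nonneg _)
  rw [mul_pow, Real.sq_sqrt hm0.le]
  exact hkey y hy

lemma aux_meas (s : ℝ) (z : ℂ) :
    AEStronglyMeasurable (fun y : ℝ => ((y ^ (s - 1) : ℝ) : ℂ) / ((y : ℂ) + z))
      (volume.restrict (Set.Ioi 0)) := by
  apply Measurable.aestronglyMeasurable
  fun_prop

lemma aux_int (s : ℝ) (hs0 : 0 < s) (hs1 : s < 1) (z : ℂ) (hz : z ∈ Complex.slitPlane) :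
    IntegrableOn (fun y : ℝ => ((y ^ (s - 1) : ℝ) : ℂ) / ((y : ℂ) + z)) (Set.Ioi 0) := by
  obtain ⟨c, hc, h⟩ := aux_lower z hz
  refine Integrable.mono' ((aux_base s hs0 hs1).1.norm.const_mul c⁻¹) (aux_meas s z) ?_
  filter_upwards [ae_restrict_mem measurableSet_Ioi] with y hy
  have hy0 : 0 < y := hy
  have := Real.rpow_pos_of_pos hy0 (s - 1)
  rw [norm_div, Complex.norm_real, Complex.norm_real, Real.norm_of_nonneg (by positivity),
    Real.norm_of_nonneg (by positivity)]
  calc y ^ (s - 1) / ‖(y : ℂ) + z‖ ≤ y ^ (s - 1) / (c * (1 + y)) := by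
        gcongr; exact h y hy0
    _ = _ := by field_simp

lemma aux_diff (s : ℝ) (hs0 : 0 < s) (hs1 : s < 1) :
    DifferentiableOn ℂ (fun z : ℂ => ∫ y in Set.Ioi (0:ℝ), ((y ^ (s - 1) : ℝ) : ℂ) / ((y : ℂ) + z))
      Complex.slitPlane := by
  intro z hz
  obtain ⟨c, hc, h⟩ := aux_lower z hz
  have hlow : ∀ y : ℝ, 0 < y → ∀ w ∈ Metric.ball z (c / 2), c / 2 * (1 + y) ≤ ‖(y : ℂ) + w‖ := by
    intro y hy w hw
    have h1 := h y hy
    have h2 : ‖w - z‖ < c / 2 := by simpa [dist_eq_norm] using hw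
    have h3 : ‖(y : ℂ) + z‖ ≤ ‖(y : ℂ) + w‖ + ‖w - z‖ := by
      have := norm_sub_le ((y : ℂ) + w) (w - z)
      rwa [show (y : ℂ) + w - (w - z) = y + z by ring] at this
    nlinarith
  have := hasDerivAt_integral_of_dominated_loc_of_deriv_le (μ := volume.restrict (Set.Ioi (0:ℝ)))
    (F := fun (z : ℂ) (y : ℝ) => ((y ^ (s - 1) : ℝ) : ℂ) / ((y : ℂ) + z))
    (F' := fun (z : ℂ) (y : ℝ) => -((y ^ (s - 1) : ℝ) : ℂ) / ((y : ℂ) + z) ^ 2)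
    (bound := fun y => ((c / 2) ^ 2)⁻¹ * ‖((y ^ (s - 1) / (1 + y) : ℝ) : ℂ)‖)
    (Metric.ball_mem_nhds z (half_pos hc))
    (Filter.Eventually.of_forall fun w => aux_meas s w) (aux_int s hs0 hs1 z hz)
    (by apply Measurable.aestronglyMeasurable; fun_prop) ?_
    ((aux_base s hs0 hs1).1.norm.const_mul _) ?_
  · exact this.2.differentiableAt.differentiableWithinAt
  · filter_upwards [ae_restrict_mem measurableSet_Ioi] with y hy w hw
    have hy0 : 0 < y := hy
    have hp := Real.rpow_pos_of_pos hy0 (s - 1)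
    rw [norm_div, norm_neg, norm_pow, Complex.norm_real, Complex.norm_real,
      Real.norm_of_nonneg (by positivity), Real.norm_of_nonneg (by positivity)]
    calc y ^ (s - 1) / ‖(y : ℂ) + w‖ ^ 2 ≤ y ^ (s - 1) / (c / 2 * (1 + y)) ^ 2 := by
          gcongr; exact hlow y hy0 w hw
      _ = ((c / 2) ^ 2)⁻¹ * (y ^ (s - 1) / (1 + y) ^ 2) := by field_simp
      _ ≤ _ := by
          gcongr
          nlinarith
  · filter_upwards [ae_restrict_mem measurableSet_Ioi] with y hy w hw
    have hy0 : 0 < y := hy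
    have hne : (y : ℂ) + w ≠ 0 := by
      rw [← norm_pos_iff]
      exact lt_of_lt_of_le (by positivity) (hlow y hy0 w hw)
    have := (hasDerivAt_const w ((y ^ (s - 1) : ℝ) : ℂ)).div ((hasDerivAt_id w).const_add (y : ℂ)) hne
    convert! this using 1
    simp

lemma aux_real (s : ℝ) (hs0 : 0 < s) (hs1 : s < 1) (t : ℝ) (ht : 0 < t) :
    ∫ y in Set.Ioi (0:ℝ), ((y ^ (s - 1) : ℝ) : ℂ) / ((y : ℂ) + (t : ℂ)) =
      π / Complex.sin (π * s) * (t : ℂ) ^ ((s : ℂ) - 1) := by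
  have h := integral_comp_mul_left_Ioi'
    (fun y : ℝ => ((y ^ (s - 1) : ℝ) : ℂ) / ((y : ℂ) + (t : ℂ))) 0 ht
  rw [mul_zero] at h
  rw [← h, ← (aux_base s hs0 hs1).2, mul_comm, ← integral_const_mul, ← integral_smul]
  refine setIntegral_congr_fun measurableSet_Ioi fun y hy => ?_
  have hy0 : 0 < y := hy
  have e2 : ((s : ℂ) - 1) = ((s - 1 : ℝ) : ℂ) := by push_cast; ring
  rw [e2, ← Complex.ofReal_cpow ht.le, ← Complex.ofReal_add, ← Complex.ofReal_div,
    Complex.real_smul, ← Complex.ofReal_mul, ← Complex.ofReal_mul]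
  congr 1
  rw [Real.mul_rpow ht.le hy0.le]
  have : 0 < t * y + t := by positivity
  field_simp
  ring

lemma aux_main (s : ℝ) (hs0 : 0 < s) (hs1 : s < 1) (z : ℂ) (hz : z ∈ Complex.slitPlane) :
    ∫ y in Set.Ioi (0:ℝ), ((y ^ (s - 1) : ℝ) : ℂ) / ((y : ℂ) + z) =
      π / Complex.sin (π * s) * z ^ ((s : ℂ) - 1) := by
  have h1 := (aux_diff s hs0 hs1).analyticOnNhd Complex.isOpen_slitPlane
  have h2 : AnalyticOnNhd ℂ (fun z : ℂ => π / Complex.sin (π * s) * z ^ ((s : ℂ) - 1))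
      Complex.slitPlane := by
    apply DifferentiableOn.analyticOnNhd _ Complex.isOpen_slitPlane
    intro w hw
    exact ((differentiableAt_id.cpow_const hw).const_mul _).differentiableWithinAt
  refine h1.eqOn_of_preconnected_of_frequently_eq h2
    (Complex.starConvex_one_slitPlane.isPathConnected Complex.one_mem_slitPlane).isConnected.isPreconnected
    Complex.one_mem_slitPlane ?_ hz
  have htend : Filter.Tendsto (fun t : ℝ => (t : ℂ)) (nhdsWithin 1 (Set.Ioi 1))
      (nhdsWithin 1 {1}ᶜ) := by
    apply tendsto_nhdsWithin_of_tendsto_nhds_of_eventually_within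
    · exact (Complex.continuous_ofReal.tendsto' 1 1 (by simp)).mono_left nhdsWithin_le_nhds
    · filter_upwards [self_mem_nhdsWithin] with t ht
      have : (1:ℝ) < t := ht
      simpa using this.ne'
  refine htend.frequently (Filter.Eventually.frequently ?_)
  filter_upwards [self_mem_nhdsWithin] with t ht
  exact aux_real s hs0 hs1 t (lt_trans one_pos ht)

lemma aux_final (β α x : ℝ)
    (hβ0 : 0 < |β|) (hβ1 : |β| < 1) (hα0 : 0 < |α|) (hα1 : |α| < Real.pi)
    (hx : 0 < x) :
    IntegrableOn (fun y : ℝ => ((y ^ β / (x ^ 2 + y ^ 2 + 2 * x * y * Real.cos α) : ℝ) : ℂ))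
      (Set.Ioi 0) ∧
    ∫ y in Set.Ioi (0 : ℝ), ((y ^ β / (x ^ 2 + y ^ 2 + 2 * x * y * Real.cos α) : ℝ) : ℂ) =
      ((x ^ (β - 1) * (Real.pi * Real.sin (β * α) / (Real.sin α * Real.sin (β * Real.pi))) : ℝ) : ℂ) := by
  obtain ⟨hb1, hb2⟩ := abs_lt.1 hβ1
  obtain ⟨ha1, ha2⟩ := abs_lt.1 hα1
  have hβ : β ≠ 0 := abs_pos.1 hβ0
  have hα : α ≠ 0 := abs_pos.1 hα0
  have hsα : Real.sin α ≠ 0 := by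
    rcases lt_or_gt_of_ne hα with h | h
    · exact (Real.sin_neg_of_neg_of_neg_pi_lt h ha1).ne
    · exact (Real.sin_pos_of_pos_of_lt_pi h ha2).ne'
  have hsβ : Real.sin (β * π) ≠ 0 := by
    rcases lt_or_gt_of_ne hβ with h | h
    · exact (Real.sin_neg_of_neg_of_neg_pi_lt (by nlinarith [pi_pos]) (by nlinarith [pi_pos])).ne
    · exact (Real.sin_pos_of_pos_of_lt_pi (by nlinarith [pi_pos]) (by nlinarith [pi_pos])).ne'
  set z : ℂ := x * Complex.exp (α * Complex.I) with hz
  set w : ℂ := x * Complex.exp ((-α : ℝ) * Complex.I) with hw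
  have hslit : ∀ a : ℝ, -π < a → a < π → (x * Complex.exp (a * Complex.I) : ℂ) ∈ Complex.slitPlane := by
    intro a h1 h2
    rw [Complex.mem_slitPlane_iff_arg]
    rw [Complex.exp_mul_I, Complex.arg_mul_cos_add_sin_mul_I hx ⟨h1, h2.le⟩, ← Complex.exp_mul_I]
    refine ⟨h2.ne, mul_ne_zero (by exact_mod_cast hx.ne') (Complex.exp_ne_zero _)⟩
  have hpow : ∀ a : ℝ, -π < a → a < π → (x * Complex.exp (a * Complex.I) : ℂ) ^ (β : ℂ) =
      (x ^ β : ℝ) * Complex.exp ((β * a : ℝ) * Complex.I) := by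
    intro a h1 h2
    have hne : (x * Complex.exp (a * Complex.I) : ℂ) ≠ 0 :=
      mul_ne_zero (by exact_mod_cast hx.ne') (Complex.exp_ne_zero _)
    rw [Complex.cpow_def_of_ne_zero hne, Complex.log_ofReal_mul hx (Complex.exp_ne_zero _),
      Complex.log_exp (by simpa using h1) (by simpa using h2.le), add_mul, Complex.exp_add,
      Real.rpow_def_of_pos hx, Complex.ofReal_exp]
    congr 2 <;> push_cast <;> ring
  have hzs := hslit α ha1 ha2
  have hws := hslit (-α) (by linarith) (by linarith)
  have hzp := hpow α ha1 ha2
  have hwp := hpow (-α) (by linarith) (by linarith)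
  rw [← hz] at hzs hzp
  rw [← hw] at hws hwp
  have hz0 := Complex.slitPlane_ne_zero hzs
  have hw0 := Complex.slitPlane_ne_zero hws
  have hzw : z - w = 2 * x * Real.sin α * Complex.I := by
    rw [hz, hw, Complex.exp_mul_I, Complex.exp_mul_I]
    push_cast
    rw [Complex.cos_neg, Complex.sin_neg]
    ring
  have hzw0 : z - w ≠ 0 := by
    rw [hzw]
    have h1 : (x : ℂ) ≠ 0 := by exact_mod_cast hx.ne'
    have h2 : (Real.sin α : ℂ) ≠ 0 := by exact_mod_cast hsα
    exact mul_ne_zero (mul_ne_zero (mul_ne_zero two_ne_zero h1) h2) Complex.I_ne_zero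
  have hpp : z ^ (β : ℂ) - w ^ (β : ℂ) = 2 * (x ^ β : ℝ) * Real.sin (β * α) * Complex.I := by
    rw [hzp, hwp, Complex.exp_mul_I, Complex.exp_mul_I, mul_neg]
    push_cast
    rw [Complex.cos_neg, Complex.sin_neg]
    ring
  have hQ : ∀ y : ℝ, ((x ^ 2 + y ^ 2 + 2 * x * y * Real.cos α : ℝ) : ℂ) = (y + z) * (y + w) := by
    intro y
    rw [hz, hw, Complex.exp_mul_I, Complex.exp_mul_I]
    push_cast
    rw [Complex.cos_neg, Complex.sin_neg]
    have h1 := Complex.sin_sq_add_cos_sq (α : ℂ)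
    linear_combination (-(x : ℂ) ^ 2) * h1 + (x : ℂ) ^ 2 * Complex.sin α ^ 2 * Complex.I_sq
  have hne : ∀ v ∈ Complex.slitPlane, ∀ y : ℝ, 0 < y → (y : ℂ) + v ≠ 0 := by
    intro v hv y hy
    obtain ⟨c, hc, h⟩ := aux_lower v hv
    rw [← norm_pos_iff]
    exact lt_of_lt_of_le (by positivity) (h y hy)
  have hval : π / Complex.sin (π * β) * ((z ^ (β : ℂ) - w ^ (β : ℂ)) / (z - w)) =
      ((x ^ (β - 1) * (Real.pi * Real.sin (β * α) / (Real.sin α * Real.sin (β * Real.pi))) : ℝ) : ℂ) := by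
    have h1 : (x : ℂ) ≠ 0 := by exact_mod_cast hx.ne'
    have h2 : (Real.sin α : ℂ) ≠ 0 := by exact_mod_cast hsα
    have h3 : (Real.sin (β * π) : ℂ) ≠ 0 := by exact_mod_cast hsβ
    have h4 : Complex.sin (π * β) = (Real.sin (β * π) : ℂ) := by
      push_cast; rw [mul_comm]
    have h5 := Complex.I_ne_zero
    rw [hpp, hzw, h4, Real.rpow_sub hx, Real.rpow_one]
    simp only [Complex.ofReal_mul, Complex.ofReal_div]
    field_simp
  rw [← hval]
  rcases lt_or_gt_of_ne hβ with h | h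
  · have hs0 : 0 < β + 1 := by linarith
    have hs1 : β + 1 < 1 := by linarith
    have key : ∀ y ∈ Set.Ioi (0:ℝ), (z - w)⁻¹ * (((y ^ (β + 1 - 1) : ℝ) : ℂ) / (y + w) -
        ((y ^ (β + 1 - 1) : ℝ) : ℂ) / (y + z)) =
        ((y ^ β / (x ^ 2 + y ^ 2 + 2 * x * y * Real.cos α) : ℝ) : ℂ) := by
      intro y hy
      have h1 := hne z hzs y hy
      have h2 := hne w hws y hy
      rw [Complex.ofReal_div, hQ, add_sub_cancel_right]
      field_simp
      ring
    have i1 := aux_int _ hs0 hs1 z hzs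
    have i2 := aux_int _ hs0 hs1 w hws
    refine ⟨IntegrableOn.congr_fun ((i2.sub i1).const_mul _) key measurableSet_Ioi, ?_⟩
    rw [← setIntegral_congr_fun measurableSet_Ioi key, integral_const_mul, integral_sub i2 i1,
      aux_main _ hs0 hs1 z hzs, aux_main _ hs0 hs1 w hws]
    have e1 : Complex.sin (π * (β + 1 : ℝ)) = - Complex.sin (π * β) := by
      push_cast
      rw [mul_add, mul_one, Complex.sin_add_pi]
    have e2 : (((β + 1 : ℝ) : ℂ) - 1) = β := by push_cast; ring
    rw [e1, e2, div_neg]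
    ring
  · have key : ∀ y ∈ Set.Ioi (0:ℝ), (z - w)⁻¹ * (z * (((y ^ (β - 1) : ℝ) : ℂ) / (y + z)) -
        w * (((y ^ (β - 1) : ℝ) : ℂ) / (y + w))) =
        ((y ^ β / (x ^ 2 + y ^ 2 + 2 * x * y * Real.cos α) : ℝ) : ℂ) := by
      intro y hy
      have h1 := hne z hzs y hy
      have h2 := hne w hws y hy
      have hy0 : 0 < y := hy
      have hyc : (y : ℂ) ≠ 0 := by exact_mod_cast hy0.ne'
      rw [Complex.ofReal_div, hQ, Real.rpow_sub hy0, Real.rpow_one, Complex.ofReal_div]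
      field_simp
      ring
    have i1 := (aux_int _ h hb2 z hzs).const_mul z
    have i2 := (aux_int _ h hb2 w hws).const_mul w
    refine ⟨IntegrableOn.congr_fun ((i1.sub i2).const_mul _) key measurableSet_Ioi, ?_⟩
    rw [← setIntegral_congr_fun measurableSet_Ioi key, integral_const_mul, integral_sub i1 i2,
      integral_const_mul, integral_const_mul,
      aux_main _ h hb2 z hzs, aux_main _ h hb2 w hws]
    rw [Complex.cpow_sub _ _ hz0, Complex.cpow_sub _ _ hw0, Complex.cpow_one, Complex.cpow_one]
    field_simp

/-- For every real `β` with `0 < |β| < 1`, every real `α` with `0 < |α| < π`, and every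
`x > 0`, the Lebesgue integral `∫₀^∞ y^β / (x² + y² + 2xy·cos α) dy` converges and equals
`x^(β−1) · π·sin(βα) / (sin α · sin(βπ))`. -/
theorem integral_rpow_div_quadratic (β α x : ℝ)
    (hβ0 : 0 < |β|) (hβ1 : |β| < 1) (hα0 : 0 < |α|) (hα1 : |α| < Real.pi)
    (hx : 0 < x) :
    IntegrableOn (fun y : ℝ => y ^ β / (x ^ 2 + y ^ 2 + 2 * x * y * Real.cos α))
      (Set.Ioi 0) ∧
    ∫ y in Set.Ioi (0 : ℝ), y ^ β / (x ^ 2 + y ^ 2 + 2 * x * y * Real.cos α) =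
      x ^ (β - 1) * (Real.pi * Real.sin (β * α) / (Real.sin α * Real.sin (β * Real.pi))) := by
  obtain ⟨h1, h2⟩ := aux_final β α x hβ0 hβ1 hα0 hα1 hx
  refine ⟨h1.re, ?_⟩
  rw [integral_complex_ofReal] at h2
  exact_mod_cast h2
end

section
/- For every real number α with 0 < α < π and every x > 0, the integral ∫₀^∞ x / (x² + y² + 2xy·cos α) dy converges and equals α / sin α. -/
open MeasureTheory Real

/-- For every real `α` with `0 < α < π` and every `x > 0`, the Lebesgue integral
`∫₀^∞ x / (x² + y² + 2xy·cos α) dy` converges and equals `α / sin α`. -/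
theorem integral_corner_kernel (α x : ℝ) (hα0 : 0 < α) (hα1 : α < Real.pi) (hx : 0 < x) :
    IntegrableOn (fun y : ℝ => x / (x ^ 2 + y ^ 2 + 2 * x * y * Real.cos α)) (Set.Ioi 0) ∧
    ∫ y in Set.Ioi (0 : ℝ), x / (x ^ 2 + y ^ 2 + 2 * x * y * Real.cos α) =
      α / Real.sin α := by
  have hs : 0 < Real.sin α := Real.sin_pos_of_pos_of_lt_pi hα0 hα1
  have hsc := Real.sin_sq_add_cos_sq α
  have key : ∀ y : ℝ, x ^ 2 + y ^ 2 + 2 * x * y * Real.cos α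
      = (x * Real.sin α) ^ 2 + (y + x * Real.cos α) ^ 2 := by
    intro y
    linear_combination (-x ^ 2) * hsc
  have hxs : 0 < x * Real.sin α := mul_pos hx hs
  have hpos : ∀ y : ℝ, 0 < x ^ 2 + y ^ 2 + 2 * x * y * Real.cos α := by
    intro y
    rw [key]
    positivity
  have hd : ∀ y ∈ Set.Ici (0 : ℝ), HasDerivAt
      (fun y : ℝ => Real.arctan ((y + x * Real.cos α) / (x * Real.sin α)) / Real.sin α)
      (x / (x ^ 2 + y ^ 2 + 2 * x * y * Real.cos α)) y := by
    intro y _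
    have h := (((((hasDerivAt_id y).add_const (x * Real.cos α)).div_const
      (x * Real.sin α))).arctan).div_const (Real.sin α)
    refine HasDerivAt.congr_deriv h ?_
    have h1 : (x * Real.sin α) ^ 2 + (y + x * Real.cos α) ^ 2 ≠ 0 := by positivity
    rw [key]
    simp only [id]
    field_simp
  have hn : ∀ y ∈ Set.Ioi (0 : ℝ), 0 ≤ x / (x ^ 2 + y ^ 2 + 2 * x * y * Real.cos α) :=
    fun y _ => div_nonneg hx.le (hpos y).le
  have hl : Filter.Tendsto
      (fun y : ℝ => Real.arctan ((y + x * Real.cos α) / (x * Real.sin α)) / Real.sin α)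
      Filter.atTop (nhds (Real.pi / 2 / Real.sin α)) := by
    refine Filter.Tendsto.div_const ?_ _
    refine (Real.tendsto_arctan_atTop.mono_right nhdsWithin_le_nhds).comp ?_
    exact (Filter.tendsto_atTop_add_const_right _ _ Filter.tendsto_id).atTop_div_const hxs
  refine ⟨integrableOn_Ioi_deriv_of_nonneg' hd hn hl, ?_⟩
  rw [integral_Ioi_of_hasDerivAt_of_nonneg' hd hn hl]
  have h0 : (0 + x * Real.cos α) / (x * Real.sin α) = Real.tan (Real.pi / 2 - α) := by
    rw [Real.tan_pi_div_two_sub, Real.tan_eq_sin_div_cos, inv_div, zero_add,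
      mul_div_mul_left _ _ hx.ne']
  simp only [h0]
  rw [Real.arctan_tan (by linarith) (by linarith)]
  ring
end

section
/- Fix p ∈ (0,1) and define the corner-kernel operator (Ku)(x) = (sin(pπ)/π) ∫₀¹ x·u(y)/(x² + y² + 2xy·cos(pπ)) dy for x ∈ (0,1]. If u is measurable on (0,1] with |u(y)| ≤ M for almost every y, then for every x ∈ (0,1] the integral converges absolutely and |(Ku)(x)| ≤ p·M; in particular the operator norm of K on L^∞(0,1] is at most p < 1. -/
open MeasureTheory Real

/-- Fix `p ∈ (0,1)`. For the corner-kernel operator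
`(Ku)(x) = (sin(pπ)/π) ∫₀¹ x·u(y)/(x² + y² + 2xy·cos(pπ)) dy`, if `u` is measurable on
`(0,1]` with `|u y| ≤ M` a.e., then for every `x ∈ (0,1]` the integral converges absolutely
and `|(Ku)(x)| ≤ p·M`; in particular the operator norm of `K` on `L^∞(0,1]` is at most
`p < 1`. -/
theorem corner_operator_unit_interval_bound (p : ℝ) (hp0 : 0 < p) (hp1 : p < 1)
    (u : ℝ → ℝ) (M : ℝ) (hu : Measurable u)
    (hM : ∀ᵐ y ∂(volume.restrict (Set.Ioc (0 : ℝ) 1)), |u y| ≤ M) :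
    ∀ x ∈ Set.Ioc (0 : ℝ) 1,
      IntegrableOn
        (fun y : ℝ => x * u y / (x ^ 2 + y ^ 2 + 2 * x * y * Real.cos (p * Real.pi)))
        (Set.Ioc 0 1) ∧
      |Real.sin (p * Real.pi) / Real.pi *
          ∫ y in Set.Ioc (0 : ℝ) 1,
            x * u y / (x ^ 2 + y ^ 2 + 2 * x * y * Real.cos (p * Real.pi))| ≤ p * M := by
  intro x hx
  obtain ⟨hx0, hx1⟩ := hx
  have hpi := Real.pi_pos
  set c := Real.cos (p * Real.pi) with hc
  set s := Real.sin (p * Real.pi) with hs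
  have hs0 : 0 < s := Real.sin_pos_of_pos_of_lt_pi (by positivity) (by nlinarith)
  have hsc : s ^ 2 + c ^ 2 = 1 := Real.sin_sq_add_cos_sq _
  have hDeq : ∀ y : ℝ, x ^ 2 + y ^ 2 + 2 * x * y * c = (x * s) ^ 2 + (y + x * c) ^ 2 := by
    intro y
    linear_combination (-x ^ 2) * hsc
  have hD : ∀ y : ℝ, 0 < x ^ 2 + y ^ 2 + 2 * x * y * c := by
    intro y
    rw [hDeq]
    positivity
  have hM0 : 0 ≤ M := by
    have : (volume.restrict (Set.Ioc (0 : ℝ) 1)) ≠ 0 := by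
      intro h
      have h2 := Measure.restrict_eq_zero.mp h
      simp at h2
    haveI : (ae (volume.restrict (Set.Ioc (0 : ℝ) 1))).NeBot := ae_neBot.mpr this
    obtain ⟨y, hy⟩ := hM.exists
    exact (abs_nonneg _).trans hy
  have hcont : Continuous (fun y : ℝ => x / (x ^ 2 + y ^ 2 + 2 * x * y * c)) := by
    apply Continuous.div (by fun_prop) (by fun_prop)
    exact fun y => (hD y).ne'
  have hgi : IntegrableOn (fun y : ℝ => M * (x / (x ^ 2 + y ^ 2 + 2 * x * y * c)))
      (Set.Ioc 0 1) :=
    ((continuous_const.mul hcont).integrableOn_Icc).mono_set Set.Ioc_subset_Icc_self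
  have hbd : ∀ᵐ y ∂(volume.restrict (Set.Ioc (0 : ℝ) 1)),
      ‖x * u y / (x ^ 2 + y ^ 2 + 2 * x * y * c)‖
        ≤ M * (x / (x ^ 2 + y ^ 2 + 2 * x * y * c)) := by
    filter_upwards [hM] with y hy
    rw [Real.norm_eq_abs, abs_div, abs_mul, abs_of_pos hx0, abs_of_pos (hD y),
      ← mul_div_assoc, mul_comm M x]
    have := (hD y).le
    gcongr
  have hmeas : Measurable (fun y : ℝ => x * u y / (x ^ 2 + y ^ 2 + 2 * x * y * c)) := by
    fun_prop
  refine ⟨Integrable.mono' hgi hmeas.aestronglyMeasurable hbd, ?_⟩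
  have h1 := norm_integral_le_of_norm_le hgi hbd
  rw [integral_const_mul, Real.norm_eq_abs] at h1
  have hder : ∀ y ∈ Set.uIcc (0 : ℝ) 1,
      HasDerivAt (fun y : ℝ => Real.arctan ((y + x * c) / (x * s)) / s)
        (x / (x ^ 2 + y ^ 2 + 2 * x * y * c)) y := by
    intro y _
    have h := (((((hasDerivAt_id y).add_const (x * c)).div_const (x * s)).arctan).div_const s)
    refine h.congr_deriv ?_
    have h3 := (hD y).ne'
    rw [hDeq] at h3 ⊢
    have h4 : 1 + ((y + x * c) / (x * s)) ^ 2
        = ((x * s) ^ 2 + (y + x * c) ^ 2) / (x * s) ^ 2 := by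
      field_simp
    simp only [id]
    rw [h4]
    field_simp
  have hint : ∫ y in Set.Ioc (0 : ℝ) 1, x / (x ^ 2 + y ^ 2 + 2 * x * y * c)
      = Real.arctan ((1 + x * c) / (x * s)) / s - Real.arctan ((0 + x * c) / (x * s)) / s := by
    rw [← intervalIntegral.integral_of_le zero_le_one]
    exact intervalIntegral.integral_eq_sub_of_hasDerivAt hder (hcont.intervalIntegrable _ _)
  have h0 : Real.arctan ((0 + x * c) / (x * s)) = Real.pi / 2 - p * Real.pi := by
    have : (0 + x * c) / (x * s) = Real.tan (Real.pi / 2 - p * Real.pi) := by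
      rw [Real.tan_eq_sin_div_cos, Real.sin_pi_div_two_sub, Real.cos_pi_div_two_sub, zero_add,
        mul_div_mul_left _ _ hx0.ne']
    rw [this]
    exact Real.arctan_tan (by nlinarith) (by nlinarith)
  have h2 := Real.arctan_lt_pi_div_two ((1 + x * c) / (x * s))
  have h5 : ∫ y in Set.Ioc (0 : ℝ) 1, x / (x ^ 2 + y ^ 2 + 2 * x * y * c)
      ≤ p * Real.pi / s := by
    rw [hint, h0, ← sub_div]
    gcongr
    linarith
  rw [abs_mul, abs_of_pos (div_pos hs0 hpi)]
  calc _ ≤ s / Real.pi * (M * (p * Real.pi / s)) := by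
        gcongr
        exact h1.trans (by gcongr)
    _ = p * M := by field_simp
end

section
/- Let α ∈ (0,1), δ > 0, M ≥ 0, and let u : (0, δ] → ℝ be continuous on (0, δ] and differentiable on (0, δ) with |u′(t)| ≤ M·t^{α−1} for all t ∈ (0, δ). Then u is integrable on (0, δ), and for every t ∈ (0, δ] one has |u(t) − (1/δ)∫₀^δ u(s) ds| ≤ (M/α)·δ^α. -/
open MeasureTheory Real

lemma corner_mono_aux (α δ M : ℝ) (hα0 : 0 < α)
    (u : ℝ → ℝ)
    (hu_cont : ContinuousOn u (Set.Ioc 0 δ))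
    (hu_diff : ∀ t ∈ Set.Ioo (0 : ℝ) δ, DifferentiableAt ℝ u t)
    (hu_deriv : ∀ t ∈ Set.Ioo (0 : ℝ) δ, |deriv u t| ≤ M * t ^ (α - 1)) :
    MonotoneOn (fun t => M / α * t ^ α + u t) (Set.Ioc 0 δ) := by
  have hd : ∀ t ∈ Set.Ioo (0 : ℝ) δ, HasDerivAt (fun t => M / α * t ^ α + u t)
      (M / α * (α * t ^ (α - 1)) + deriv u t) t := fun t ht =>
    ((Real.hasDerivAt_rpow_const (Or.inl ht.1.ne')).const_mul _).add (hu_diff t ht).hasDerivAt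
  apply monotoneOn_of_deriv_nonneg (convex_Ioc 0 δ)
  · refine ContinuousOn.add ?_ hu_cont
    exact (continuous_const.mul (Real.continuous_rpow_const hα0.le)).continuousOn
  · rw [interior_Ioc]
    exact fun t ht => (hd t ht).differentiableAt.differentiableWithinAt
  · rw [interior_Ioc]
    intro t ht
    rw [(hd t ht).deriv]
    have h1 := (abs_le.1 (hu_deriv t ht)).1
    have h2 : M / α * (α * t ^ (α - 1)) = M * t ^ (α - 1) := by field_simp
    linarith

/-- Near-corner estimate: if `α ∈ (0,1)`, `δ > 0`, `M ≥ 0`, and `u : (0,δ] → ℝ` is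
continuous on `(0,δ]`, differentiable on `(0,δ)` with `|u′(t)| ≤ M·t^(α−1)` there, then
`u` is integrable on `(0,δ)` and for every `t ∈ (0,δ]` we have
`|u(t) − (1/δ)∫₀^δ u| ≤ (M/α)·δ^α`. -/
theorem mean_value_projection_corner_estimate (α δ M : ℝ)
    (hα0 : 0 < α) (hα1 : α < 1) (hδ : 0 < δ) (hM : 0 ≤ M)
    (u : ℝ → ℝ)
    (hu_cont : ContinuousOn u (Set.Ioc 0 δ))
    (hu_diff : ∀ t ∈ Set.Ioo (0 : ℝ) δ, DifferentiableAt ℝ u t)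
    (hu_deriv : ∀ t ∈ Set.Ioo (0 : ℝ) δ, |deriv u t| ≤ M * t ^ (α - 1)) :
    IntegrableOn u (Set.Ioc 0 δ) ∧
    ∀ t ∈ Set.Ioc (0 : ℝ) δ,
      |u t - (1 / δ) * ∫ s in Set.Ioc (0 : ℝ) δ, u s| ≤ (M / α) * δ ^ α := by
  have key : ∀ s ∈ Set.Ioc (0 : ℝ) δ, ∀ t ∈ Set.Ioc (0 : ℝ) δ, s ≤ t →
      |u t - u s| ≤ (M / α) * δ ^ α := by
    intro s hs t ht hst
    have h1 := corner_mono_aux α δ M hα0 u hu_cont hu_diff hu_deriv hs ht hst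
    have h2 := corner_mono_aux α δ M hα0 (fun x => - u x) hu_cont.neg
      (fun x hx => (hu_diff x hx).neg)
      (fun x hx => by simpa [deriv.fun_neg] using hu_deriv x hx) hs ht hst
    have hMα : 0 ≤ M / α := div_nonneg hM hα0.le
    have h3 : M / α * t ^ α ≤ M / α * δ ^ α :=
      mul_le_mul_of_nonneg_left (Real.rpow_le_rpow ht.1.le ht.2 hα0.le) hMα
    have h4 : 0 ≤ M / α * s ^ α := mul_nonneg hMα (Real.rpow_nonneg hs.1.le _)
    simp only at h1 h2
    rw [abs_le]
    constructor <;> linarith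
  have key2 : ∀ s ∈ Set.Ioc (0 : ℝ) δ, ∀ t ∈ Set.Ioc (0 : ℝ) δ,
      |u t - u s| ≤ (M / α) * δ ^ α := by
    intro s hs t ht
    rcases le_total s t with h | h
    · exact key s hs t ht h
    · rw [abs_sub_comm]; exact key t ht s hs h
  have hδm : δ ∈ Set.Ioc (0 : ℝ) δ := ⟨hδ, le_rfl⟩
  have hint : IntegrableOn u (Set.Ioc 0 δ) := by
    refine IntegrableOn.of_bound (C := |u δ| + (M / α) * δ ^ α) measure_Ioc_lt_top
      (hu_cont.aestronglyMeasurable measurableSet_Ioc) ?_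
    filter_upwards [ae_restrict_mem measurableSet_Ioc] with s hs
    have h1 := key2 δ hδm s hs
    have h2 := abs_sub_abs_le_abs_sub (u s) (u δ)
    rw [Real.norm_eq_abs]
    linarith
  refine ⟨hint, fun t ht => ?_⟩
  have hb := norm_setIntegral_le_of_norm_le_const (μ := volume) (s := Set.Ioc (0 : ℝ) δ)
    (f := fun s => u t - u s) measure_Ioc_lt_top (fun s hs => key2 s hs t ht)
  have hc : IntegrableOn (fun _ : ℝ => u t) (Set.Ioc 0 δ) :=
    integrableOn_const measure_Ioc_lt_top.ne
  rw [integral_sub hc hint, setIntegral_const] at hb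
  simp only [Real.volume_real_Ioc_of_le hδ.le, sub_zero, smul_eq_mul, Real.norm_eq_abs] at hb
  have he : u t - (1 / δ) * ∫ s in Set.Ioc (0 : ℝ) δ, u s
      = (δ * u t - ∫ s in Set.Ioc (0 : ℝ) δ, u s) / δ := by field_simp
  rw [he, abs_div, abs_of_pos hδ, div_le_iff₀ hδ]
  exact hb
end

section
/- There is an absolute constant C > 0 with the following property. Let τ = [a, b] be a compact interval of length h_τ = b − a, let u be four times continuously differentiable on τ and g three times continuously differentiable on τ, and let ū = (1/h_τ)∫_τ u(t) dt be the mean value of u on τ. Then ∫_τ (u(t) − ū)·g(t) dt = (h_τ²/12)·∫_τ u′(t)·g′(t) dt + γ_τ, where |γ_τ| ≤ C·h_τ⁴·∑_{i=0}^{3} ‖u^{(4−i)}‖_{L^∞(τ)}·‖g^{(i)}‖_{L¹(τ)}. -/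
open MeasureTheory Real intervalIntegral

lemma aux_mv {a b B : ℝ} {f f' : ℝ → ℝ} (hc : ContinuousOn f (Set.Icc a b))
    (hd : ∀ x ∈ Set.Ioo a b, HasDerivAt f (f' x) x) (hB : ∀ x ∈ Set.Ioo a b, |f' x| ≤ B)
    (hB0 : 0 ≤ B) (x y : ℝ) (hx : x ∈ Set.Icc a b) (hy : y ∈ Set.Icc a b) :
    |f x - f y| ≤ B * (b - a) := by
  have key : ∀ x ∈ Set.Icc a b, ∀ y ∈ Set.Icc a b, x < y → |f y - f x| ≤ B * (b - a) := by
    intro x hx y hy hxy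
    obtain ⟨c, hc', he⟩ := exists_hasDerivAt_eq_slope f f' hxy
      (hc.mono (Set.Icc_subset_Icc hx.1 hy.2))
      (fun z hz => hd z ⟨lt_of_le_of_lt hx.1 hz.1, lt_of_lt_of_le hz.2 hy.2⟩)
    have h1 := hB c ⟨lt_of_le_of_lt hx.1 hc'.1, lt_of_lt_of_le hc'.2 hy.2⟩
    have h2 : f y - f x = f' c * (y - x) := by
      rw [he]; field_simp [sub_ne_zero.mpr hxy.ne']
    rw [h2, abs_mul, abs_of_pos (sub_pos.mpr hxy)]
    apply mul_le_mul h1 _ (sub_pos.mpr hxy).le hB0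
    linarith [hx.1, hy.2]
  rcases lt_trichotomy x y with h | h | h
  · rw [abs_sub_comm]; exact key x hx y hy h
  · subst h; simp; exact mul_nonneg hB0 (by linarith [hx.1, hx.2])
  · exact key y hy x hx h

lemma aux_S {a b M : ℝ} (hab : a < b) {u0 u1 u2 u3 : ℝ → ℝ} {U : ℝ → ℝ} {v : ℝ}
    (hUc : ContinuousOn U (Set.Icc a b))
    (hU : ∀ x ∈ Set.Ioo a b, HasDerivAt U (u0 x - v) x) (hUa : U a = 0) (hUb : U b = 0)
    (c0 : ContinuousOn u0 (Set.Icc a b)) (c1 : ContinuousOn u1 (Set.Icc a b))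
    (c2 : ContinuousOn u2 (Set.Icc a b))
    (d0 : ∀ x ∈ Set.Ioo a b, HasDerivAt u0 (u1 x) x)
    (d1 : ∀ x ∈ Set.Ioo a b, HasDerivAt u1 (u2 x) x)
    (d2 : ∀ x ∈ Set.Ioo a b, HasDerivAt u2 (u3 x) x)
    (hM : ∀ x ∈ Set.Icc a b, |u3 x| ≤ M) (hM0 : 0 ≤ M) :
    ∀ x ∈ Set.Icc a b, |U x + (b - x) * (x - a) / 2 * u1 x
      - (x - (a + b) / 2) * ((b - x) * (x - a)) / 3 * u2 x| ≤ (b - a) ^ 4 / 4 * M := by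
  have hh : 0 < b - a := sub_pos.mpr hab
  set T : ℝ → ℝ := fun x => u0 x - v - (x - (a + b) / 2) * u1 x +
    ((x - (a + b) / 2) ^ 2 / 2 + (b - a) ^ 2 / 24) * u2 x with hT
  set S : ℝ → ℝ := fun x => U x + (b - x) * (x - a) / 2 * u1 x
      - (x - (a + b) / 2) * ((b - x) * (x - a)) / 3 * u2 x with hS
  have hk : ∀ x : ℝ, HasDerivAt (fun x : ℝ => x - (a + b) / 2) 1 x :=
    fun x => (hasDerivAt_id x).sub_const _
  have hE : ∀ x : ℝ, HasDerivAt (fun x : ℝ => (b - x) * (x - a)) (-1 * (x - a) + (b - x) * 1) x :=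
    fun x => ((hasDerivAt_id x).const_sub b).mul ((hasDerivAt_id x).sub_const a)
  have dT : ∀ x ∈ Set.Ioo a b, HasDerivAt T
      (((x - (a + b) / 2) ^ 2 / 2 + (b - a) ^ 2 / 24) * u3 x) x := by
    intro x hx
    have := (((d0 x hx).sub_const v).sub ((hk x).mul (d1 x hx))).add
      (((((hk x).pow 2).div_const 2).add_const ((b - a) ^ 2 / 24)).mul (d2 x hx))
    refine this.congr_deriv ?_
    simp
  have dS : ∀ x ∈ Set.Ioo a b, HasDerivAt S
      (T x - (x - (a + b) / 2) * ((b - x) * (x - a)) / 3 * u3 x) x := by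
    intro x hx
    have := ((hU x hx).add (((hE x).div_const 2).mul (d1 x hx))).sub
      ((((hk x).mul (hE x)).div_const 3).mul (d2 x hx))
    refine this.congr_deriv ?_
    simp [hT]
    ring
  have cT : ContinuousOn T (Set.Icc a b) := by fun_prop
  have cS : ContinuousOn S (Set.Icc a b) := by fun_prop
  have kb : ∀ x ∈ Set.Icc a b, |x - (a + b) / 2| ≤ (b - a) / 2 := by
    intro x hx
    rw [abs_le]; constructor <;> linarith [hx.1, hx.2]
  have eb : ∀ x ∈ Set.Icc a b, |(b - x) * (x - a)| ≤ (b - a) ^ 2 / 4 := by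
    intro x hx
    rw [abs_of_nonneg (mul_nonneg (by linarith [hx.2]) (by linarith [hx.1]))]
    nlinarith [sq_nonneg (x - (a + b) / 2)]
  have k3 : ∀ x ∈ Set.Icc a b, |(x - (a + b) / 2) * ((b - x) * (x - a)) / 3 * u3 x|
      ≤ (b - a) ^ 3 / 24 * M := by
    intro x hx
    rw [abs_mul]
    apply mul_le_mul _ (hM x hx) (abs_nonneg _) (by positivity)
    rw [abs_div, abs_mul, abs_of_pos (by norm_num : (0 : ℝ) < 3)]
    have := mul_le_mul (kb x hx) (eb x hx) (abs_nonneg _) (by positivity)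
    linarith
  have bT : ∀ x ∈ Set.Ioo a b, |((x - (a + b) / 2) ^ 2 / 2 + (b - a) ^ 2 / 24) * u3 x|
      ≤ (b - a) ^ 2 / 6 * M := by
    intro x hx
    have hx' := Set.Ioo_subset_Icc_self hx
    rw [abs_mul]
    apply mul_le_mul _ (hM x hx') (abs_nonneg _) (by positivity)
    rw [abs_of_nonneg (by positivity)]
    nlinarith [mul_nonneg (by linarith [hx.2] : 0 ≤ b - x) (by linarith [hx.1] : 0 ≤ x - a)]
  have Sa : S a = 0 := by simp [hS, hUa]
  have Sb : S b = 0 := by simp [hS, hUb]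
  obtain ⟨ξ, hξ, hz⟩ := exists_hasDerivAt_eq_zero hab cS (Sa.trans Sb.symm) dS
  have hξ' := Set.Ioo_subset_Icc_self hξ
  have bS : ∀ x ∈ Set.Ioo a b, |T x - (x - (a + b) / 2) * ((b - x) * (x - a)) / 3 * u3 x|
      ≤ (b - a) ^ 3 / 4 * M := by
    intro x hx
    have hx' := Set.Ioo_subset_Icc_self hx
    have h1 := aux_mv cT dT bT (by positivity) x ξ hx' hξ'
    have h2 := abs_le.mp (k3 x hx')
    have h3 := abs_le.mp (k3 ξ hξ')
    have h4 := abs_le.mp h1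
    rw [abs_le]
    constructor <;> linarith
  intro x hx
  have := aux_mv cS dS bS (by positivity) x a hx ⟨le_rfl, hab.le⟩
  rw [Sa, sub_zero] at this
  refine this.trans (le_of_eq ?_)
  ring

lemma aux_id {a b : ℝ} (hab : a < b) {u0 u1 u2 u3 g0 g1 g2 g3 : ℝ → ℝ} {U : ℝ → ℝ} {v : ℝ}
    (hUc : ContinuousOn U (Set.Icc a b))
    (hU : ∀ x ∈ Set.Ioo a b, HasDerivAt U (u0 x - v) x) (hUa : U a = 0) (hUb : U b = 0)
    (c0 : ContinuousOn u0 (Set.Icc a b)) (c1 : ContinuousOn u1 (Set.Icc a b))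
    (c2 : ContinuousOn u2 (Set.Icc a b)) (c3 : ContinuousOn u3 (Set.Icc a b))
    (e0 : ContinuousOn g0 (Set.Icc a b)) (e1 : ContinuousOn g1 (Set.Icc a b))
    (e2 : ContinuousOn g2 (Set.Icc a b)) (e3 : ContinuousOn g3 (Set.Icc a b))
    (d1 : ∀ x ∈ Set.Ioo a b, HasDerivAt u1 (u2 x) x)
    (d2 : ∀ x ∈ Set.Ioo a b, HasDerivAt u2 (u3 x) x)
    (f0 : ∀ x ∈ Set.Ioo a b, HasDerivAt g0 (g1 x) x)
    (f1 : ∀ x ∈ Set.Ioo a b, HasDerivAt g1 (g2 x) x)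
    (f2 : ∀ x ∈ Set.Ioo a b, HasDerivAt g2 (g3 x) x) :
    (∫ t in a..b, (u0 t - v) * g0 t) - (b - a) ^ 2 / 12 * (∫ t in a..b, u1 t * g1 t) =
      ∫ x in a..b, (-(U x + (b - x) * (x - a) / 2 * u1 x
      - (x - (a + b) / 2) * ((b - x) * (x - a)) / 3 * u2 x) * g1 x
      - ((b - x) * (x - a)) ^ 2 / 24 * (3 * u3 x * g1 x + 4 * u2 x * g2 x + u1 x * g3 x)) := by
  have hk : ∀ x : ℝ, HasDerivAt (fun x : ℝ => x - (a + b) / 2) 1 x :=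
    fun x => (hasDerivAt_id x).sub_const _
  have hE : ∀ x : ℝ, HasDerivAt (fun x : ℝ => (b - x) * (x - a)) (-1 * (x - a) + (b - x) * 1) x :=
    fun x => ((hasDerivAt_id x).const_sub b).mul ((hasDerivAt_id x).sub_const a)
  have ii : ∀ f : ℝ → ℝ, ContinuousOn f (Set.Icc a b) → IntervalIntegrable f volume a b :=
    fun f hf => ContinuousOn.intervalIntegrable (by rwa [Set.uIcc_of_le hab.le])
  have key := integral_eq_sub_of_hasDerivAt_of_le (a := a) (b := b) hab.le
    (f := fun x => U x * g0 x + (x - (a + b) / 2) * ((b - x) * (x - a)) / 6 * (u1 x * g1 x)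
      + ((b - x) * (x - a)) ^ 2 / 24 * (3 * (u2 x * g1 x) + u1 x * g2 x))
    (f' := fun x => (u0 x - v) * g0 x - (b - a) ^ 2 / 12 * (u1 x * g1 x) -
      (-(U x + (b - x) * (x - a) / 2 * u1 x
      - (x - (a + b) / 2) * ((b - x) * (x - a)) / 3 * u2 x) * g1 x
      - ((b - x) * (x - a)) ^ 2 / 24 * (3 * u3 x * g1 x + 4 * u2 x * g2 x + u1 x * g3 x)))
    (by fun_prop)
    (by
      intro x hx
      have := (((hU x hx).mul (f0 x hx)).add
        ((((hk x).mul (hE x)).div_const 6).mul ((d1 x hx).mul (f1 x hx)))).add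
        ((((hE x).pow 2).div_const 24).mul
          ((((d2 x hx).mul (f1 x hx)).const_mul 3).add ((d1 x hx).mul (f2 x hx))))
      refine this.congr_deriv ?_
      simp
      ring)
    (ii _ (by fun_prop))
  rw [intervalIntegral.integral_sub (ii _ (by fun_prop)) (ii _ (by fun_prop)),
    intervalIntegral.integral_sub (ii _ (by fun_prop)) (ii _ (by fun_prop)),
    intervalIntegral.integral_const_mul] at key
  simp only [hUa, hUb] at key
  linarith

lemma aux_der {a b : ℝ} (hab : a < b) {f : ℝ → ℝ} {n : ℕ} (hf : ContDiffOn ℝ n f (Set.Icc a b))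
    (k : ℕ) (hk : k < n) : ∀ x ∈ Set.Ioo a b, HasDerivAt (iteratedDerivWithin k f (Set.Icc a b))
      (iteratedDerivWithin (k + 1) f (Set.Icc a b) x) x := by
  intro x hx
  rw [iteratedDerivWithin_succ]
  have h := hf.differentiableOn_iteratedDerivWithin (m := k) (by exact_mod_cast hk)
    (uniqueDiffOn_Icc hab) x (Set.Ioo_subset_Icc_self hx)
  exact h.hasDerivWithinAt.hasDerivAt (Icc_mem_nhds hx.1 hx.2)

/-- Euler–Maclaurin type expansion on a single mesh interval: there is an absolute
constant `C > 0` such that for every compact interval `τ = [a,b]` with `h_τ = b − a`,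
every `u ∈ C⁴(τ)` and `g ∈ C³(τ)`, writing `ū` for the mean value of `u` on `τ`,
`∫_τ (u − ū)·g = (h_τ²/12)·∫_τ u′·g′ + γ_τ` with
`|γ_τ| ≤ C·h_τ⁴·∑_{i=0}^{3} ‖u^{(4−i)}‖_{L^∞(τ)}·‖g^{(i)}‖_{L¹(τ)}`. -/
theorem projection_error_expansion_single_interval :
    ∃ C : ℝ, 0 < C ∧
      ∀ a b : ℝ, a < b → ∀ u g : ℝ → ℝ,
        ContDiffOn ℝ 4 u (Set.Icc a b) → ContDiffOn ℝ 3 g (Set.Icc a b) →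
        ∃ γ : ℝ,
          (∫ t in a..b, (u t - (1 / (b - a)) * ∫ s in a..b, u s) * g t) =
            ((b - a) ^ 2 / 12) * (∫ t in a..b,
              derivWithin u (Set.Icc a b) t * derivWithin g (Set.Icc a b) t) + γ ∧
          |γ| ≤ C * (b - a) ^ 4 *
            ∑ i ∈ Finset.range 4,
              sSup ((fun t => |iteratedDerivWithin (4 - i) u (Set.Icc a b) t|) '' Set.Icc a b) *
                ∫ t in a..b, |iteratedDerivWithin i g (Set.Icc a b) t| := by
  refine ⟨1, one_pos, fun a b hab u g hu hg => ⟨_, (add_sub_cancel _ _).symm, ?_⟩⟩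
  have hh : 0 < b - a := sub_pos.mpr hab
  have cu : ∀ k : ℕ, k ≤ 4 → ContinuousOn (iteratedDerivWithin k u (Set.Icc a b)) (Set.Icc a b) :=
    fun k hk => hu.continuousOn_iteratedDerivWithin (by exact_mod_cast hk) (uniqueDiffOn_Icc hab)
  have cg : ∀ k : ℕ, k ≤ 3 → ContinuousOn (iteratedDerivWithin k g (Set.Icc a b)) (Set.Icc a b) :=
    fun k hk => hg.continuousOn_iteratedDerivWithin (by exact_mod_cast hk) (uniqueDiffOn_Icc hab)
  have du := aux_der hab (n := 4) (by exact_mod_cast hu)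
  have dg := aux_der hab (n := 3) (by exact_mod_cast hg)
  have hM : ∀ k : ℕ, k ≤ 4 → ∀ x ∈ Set.Icc a b, |iteratedDerivWithin k u (Set.Icc a b) x| ≤
      sSup ((fun t => |iteratedDerivWithin k u (Set.Icc a b) t|) '' Set.Icc a b) := by
    intro k hk x hx
    exact le_csSup (isCompact_Icc.bddAbove_image (cu k hk).abs) ⟨x, hx, rfl⟩
  have hM0 : ∀ k : ℕ, k ≤ 4 → 0 ≤
      sSup ((fun t => |iteratedDerivWithin k u (Set.Icc a b) t|) '' Set.Icc a b) :=
    fun k hk => (abs_nonneg _).trans (hM k hk a ⟨le_rfl, hab.le⟩)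
  have ii : ∀ f : ℝ → ℝ, ContinuousOn f (Set.Icc a b) → IntervalIntegrable f volume a b :=
    fun f hf => ContinuousOn.intervalIntegrable (by rwa [Set.uIcc_of_le hab.le])
  have eu : derivWithin u (Set.Icc a b) = iteratedDerivWithin 1 u (Set.Icc a b) :=
    iteratedDerivWithin_one.symm
  have eg : derivWithin g (Set.Icc a b) = iteratedDerivWithin 1 g (Set.Icc a b) :=
    iteratedDerivWithin_one.symm
  rw [eu, eg]
  simp only [Finset.sum_range_succ, Finset.sum_range_zero, zero_add, Nat.sub_zero,
    show 4 - 1 = 3 from rfl, show 4 - 2 = 2 from rfl, show 4 - 3 = 1 from rfl]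
  have cu0 := cu 0 (by norm_num)
  have cu1 := cu 1 (by norm_num)
  have cu2 := cu 2 (by norm_num)
  have cu3 := cu 3 (by norm_num)
  have cg0 := cg 0 (by norm_num)
  have cg1 := cg 1 (by norm_num)
  have cg2 := cg 2 (by norm_num)
  have cg3 := cg 3 (by norm_num)
  have du0 := du 0 (by norm_num)
  have du1 := du 1 (by norm_num)
  have du2 := du 2 (by norm_num)
  have dg0 := dg 0 (by norm_num)
  have dg1 := dg 1 (by norm_num)
  have dg2 := dg 2 (by norm_num)
  have M1 := hM 1 (by norm_num)
  have M2 := hM 2 (by norm_num)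
  have M3 := hM 3 (by norm_num)
  have N1 := hM0 1 (by norm_num)
  have N2 := hM0 2 (by norm_num)
  have N3 := hM0 3 (by norm_num)
  have N4 := hM0 4 (by norm_num)
  simp only [iteratedDerivWithin_zero, zero_add, Nat.reduceAdd] at cu0 cg0 du0 dg0 du1 du2 dg1 dg2 ⊢
  clear hM hM0 du dg cu cg
  generalize iteratedDerivWithin 1 u (Set.Icc a b) = u1 at *
  generalize iteratedDerivWithin 2 u (Set.Icc a b) = u2 at *
  generalize iteratedDerivWithin 3 u (Set.Icc a b) = u3 at *
  generalize iteratedDerivWithin 4 u (Set.Icc a b) = u4 at *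
  generalize iteratedDerivWithin 1 g (Set.Icc a b) = g1 at *
  generalize iteratedDerivWithin 2 g (Set.Icc a b) = g2 at *
  generalize iteratedDerivWithin 3 g (Set.Icc a b) = g3 at *
  generalize sSup ((fun t => |u1 t|) '' Set.Icc a b) = m1 at *
  generalize sSup ((fun t => |u2 t|) '' Set.Icc a b) = m2 at *
  generalize sSup ((fun t => |u3 t|) '' Set.Icc a b) = m3 at *
  generalize sSup ((fun t => |u4 t|) '' Set.Icc a b) = m4 at *
  set v := (1 / (b - a)) * ∫ s in a..b, u s with hv
  set U : ℝ → ℝ := fun x => (∫ s in a..x, u s) - v * (x - a) with hUdef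
  have hUa : U a = 0 := by simp [hUdef]
  have hUb : U b = 0 := by simp only [hUdef, hv]; field_simp; ring
  have hUc : ContinuousOn U (Set.Icc a b) := by
    have : ContinuousOn (fun x => ∫ s in a..x, u s) (Set.Icc a b) := by
      have := intervalIntegral.continuousOn_primitive_interval (f := u) (μ := volume) (a := a)
        (b := b) (by rw [Set.uIcc_of_le hab.le]; exact cu0.integrableOn_Icc)
      rwa [Set.uIcc_of_le hab.le] at this
    fun_prop
  have hU : ∀ x ∈ Set.Ioo a b, HasDerivAt U (u x - v) x := by
    intro x hx
    have h1 : HasDerivAt (fun x => ∫ s in a..x, u s) (u x) x := by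
      apply intervalIntegral.integral_hasDerivAt_right
      · apply ContinuousOn.intervalIntegrable
        rw [Set.uIcc_of_le hx.1.le]
        exact cu0.mono (Set.Icc_subset_Icc le_rfl hx.2.le)
      · exact ContinuousOn.stronglyMeasurableAtFilter isOpen_Ioo
          (cu0.mono Set.Ioo_subset_Icc_self) x hx
      · exact cu0.continuousAt (Icc_mem_nhds hx.1 hx.2)
    have := h1.sub (((hasDerivAt_id x).sub_const a).const_mul v)
    refine this.congr_deriv ?_
    simp
  have hS := aux_S hab hUc hU hUa hUb cu0 cu1 cu2 du0 du1 du2 M3 N3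
  rw [aux_id hab hUc hU hUa hUb cu0 cu1 cu2 cu3 cg0 cg1 cg2 cg3 du1 du2 dg0 dg1 dg2]
  have step : ∀ x ∈ Set.Icc a b, |(-(U x + (b - x) * (x - a) / 2 * u1 x
      - (x - (a + b) / 2) * ((b - x) * (x - a)) / 3 * u2 x) * g1 x
      - ((b - x) * (x - a)) ^ 2 / 24 * (3 * u3 x * g1 x + 4 * u2 x * g2 x + u1 x * g3 x))|
      ≤ (b - a) ^ 4 * (m3 * |g1 x| + m2 * |g2 x| + m1 * |g3 x|) := by
    intro x hx
    have hSx := hS x hx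
    generalize U x + (b - x) * (x - a) / 2 * u1 x
      - (x - (a + b) / 2) * ((b - x) * (x - a)) / 3 * u2 x = s at hSx ⊢
    have e1 : 0 ≤ (b - x) * (x - a) := mul_nonneg (by linarith [hx.2]) (by linarith [hx.1])
    have e2 : (b - x) * (x - a) ≤ (b - a) ^ 2 / 4 := by
      nlinarith [sq_nonneg (x - (a + b) / 2)]
    have e3 : ((b - x) * (x - a)) ^ 2 / 24 ≤ (b - a) ^ 4 / 384 := by
      have := pow_le_pow_left₀ e1 e2 2
      nlinarith
    have e4 : 0 ≤ ((b - x) * (x - a)) ^ 2 / 24 := by positivity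
    generalize ((b - x) * (x - a)) ^ 2 / 24 = q at e3 e4 ⊢
    have hp : 0 ≤ (b - a) ^ 4 := by positivity
    generalize (b - a) ^ 4 = p at *
    have t1 : |s| * |g1 x| ≤ p / 4 * m3 * |g1 x| :=
      mul_le_mul_of_nonneg_right hSx (abs_nonneg _)
    have t2 : |3 * u3 x * g1 x + 4 * u2 x * g2 x + u1 x * g3 x| ≤
        3 * (m3 * |g1 x|) + 4 * (m2 * |g2 x|) + m1 * |g3 x| := by
      refine (abs_add_three _ _ _).trans ?_
      simp only [abs_mul, mul_assoc]
      rw [abs_of_pos (by norm_num : (0 : ℝ) < 3), abs_of_pos (by norm_num : (0 : ℝ) < 4)]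
      have := M1 x hx
      have := M2 x hx
      have := M3 x hx
      gcongr
    have t3 := mul_le_mul e3 t2 (abs_nonneg _) (by positivity)
    have t4 : |-s * g1 x - q * (3 * u3 x * g1 x + 4 * u2 x * g2 x + u1 x * g3 x)| ≤
        |s| * |g1 x| + q * |3 * u3 x * g1 x + 4 * u2 x * g2 x + u1 x * g3 x| := by
      refine (abs_sub _ _).trans ?_
      rw [abs_mul, abs_neg, abs_mul, abs_of_nonneg e4]
    have n1 : 0 ≤ p * (m3 * |g1 x|) := by positivity
    have n2 : 0 ≤ p * (m2 * |g2 x|) := by positivity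
    have n3 : 0 ≤ p * (m1 * |g3 x|) := by positivity
    nlinarith
  refine (intervalIntegral.abs_integral_le_integral_abs hab.le).trans ?_
  refine (intervalIntegral.integral_mono_on hab.le (ii _ (by fun_prop)) (ii _ (by fun_prop))
    step).trans ?_
  rw [intervalIntegral.integral_const_mul,
    intervalIntegral.integral_add (ii _ (by fun_prop)) (ii _ (by fun_prop)),
    intervalIntegral.integral_add (ii _ (by fun_prop)) (ii _ (by fun_prop)),
    intervalIntegral.integral_const_mul, intervalIntegral.integral_const_mul,
    intervalIntegral.integral_const_mul, one_mul]
  apply mul_le_mul_of_nonneg_left _ (by positivity)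
  have : 0 ≤ m4 * ∫ t in a..b, |g t| :=
    mul_nonneg N4 (intervalIntegral.integral_nonneg hab.le fun _ _ => abs_nonneg _)
  linarith
end

section
/- Let X be a Banach space, let T : X → X be a compact continuous linear operator, and let (π_n) be a sequence of continuous linear operators on X such that π_n x → x for every x ∈ X. Define T_n^M = π_n T π_n + π_n T (I − π_n) + (I − π_n) T π_n. Then ‖T − T_n^M‖ = ‖(I − π_n) T (I − π_n)‖ → 0 in operator norm as n → ∞. -/
open ContinuousLinearMap Filter

/-- Kulkarni's modified projection operator
`T^M = πTπ + πT(I − π) + (I − π)Tπ` built from a projection-type operator `π`. -/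
noncomputable def modifiedProj {X : Type*} [NormedAddCommGroup X] [NormedSpace ℝ X]
    (T π : X →L[ℝ] X) : X →L[ℝ] X :=
  π ∘L T ∘L π + π ∘L T ∘L (ContinuousLinearMap.id ℝ X - π) +
    (ContinuousLinearMap.id ℝ X - π) ∘L T ∘L π

/-- If `X` is a Banach space, `T : X → X` is a compact continuous linear operator, and
`(π_n)` are continuous linear operators converging pointwise to the identity, then for
`T_n^M = π_n T π_n + π_n T (I − π_n) + (I − π_n) T π_n` one has
`‖T − T_n^M‖ = ‖(I − π_n) T (I − π_n)‖ → 0`. -/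
theorem modifiedProj_norm_tendsto_zero {X : Type*} [NormedAddCommGroup X]
    [NormedSpace ℝ X] [CompleteSpace X]
    (T : X →L[ℝ] X) (hT : IsCompactOperator T)
    (π : ℕ → X →L[ℝ] X)
    (hπ : ∀ x : X, Tendsto (fun n => π n x) atTop (nhds x)) :
    (∀ n : ℕ, ‖T - modifiedProj T (π n)‖ =
      ‖(ContinuousLinearMap.id ℝ X - π n) ∘L T ∘L (ContinuousLinearMap.id ℝ X - π n)‖) ∧
    Tendsto (fun n => ‖T - modifiedProj T (π n)‖) atTop (nhds 0) := by
  have key : ∀ n : ℕ, T - modifiedProj T (π n) =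
      (ContinuousLinearMap.id ℝ X - π n) ∘L T ∘L (ContinuousLinearMap.id ℝ X - π n) := by
    intro n
    ext x
    simp [modifiedProj]
    abel
  refine ⟨fun n => by rw [key n], ?_⟩
  simp only [key]
  have hE : ∀ x : X, Tendsto (fun n => (ContinuousLinearMap.id ℝ X - π n) x) atTop (nhds 0) := by
    intro x
    have := (tendsto_const_nhds (x := x)).sub (hπ x)
    simpa using this
  generalize hEdef : (fun n => ContinuousLinearMap.id ℝ X - π n) = E at *
  have hEn : ∀ n, ContinuousLinearMap.id ℝ X - π n = E n := fun n => by rw [← hEdef]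
  simp only [hEn] at hE ⊢
  obtain ⟨C, hC⟩ : ∃ C, ∀ n, ‖E n‖ ≤ C := by
    apply banach_steinhaus
    intro x
    obtain ⟨M, hM⟩ := (hE x).norm.bddAbove_range
    exact ⟨M, fun n => hM ⟨n, rfl⟩⟩
  have hC0 : 0 ≤ C := (norm_nonneg _).trans (hC 0)
  have hET : Tendsto (fun n => ‖E n ∘L T‖) atTop (nhds 0) := by
    rw [Metric.tendsto_atTop']
    intro ε hε
    obtain ⟨K, hK, hKs⟩ := hT.image_closedBall_subset_compact (f := (T : X →ₗ[ℝ] X)) 1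
    set δ := ε / (2 * (C + 1)) with hδ
    have hδ0 : 0 < δ := by positivity
    obtain ⟨t, ht, hcov⟩ := Metric.totallyBounded_iff.1 hK.totallyBounded δ hδ0
    have hev : ∀ᶠ n in atTop, ∀ y ∈ t, ‖E n y‖ < δ := by
      rw [eventually_all_finite ht]
      intro y _
      have := (hE y).norm
      rw [norm_zero] at this
      exact this.eventually_lt_const hδ0
    obtain ⟨N, hN⟩ := eventually_atTop.1 hev
    refine ⟨N, fun n hn => ?_⟩
    have hb : ‖E n ∘L T‖ ≤ (C + 1) * δ := by
      refine ContinuousLinearMap.opNorm_le_of_unit_norm (by positivity) fun x hx => ?_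
      have hxK : T x ∈ K := hKs ⟨x, by simp [hx], rfl⟩
      have := hcov hxK
      simp only [Set.mem_iUnion, Metric.mem_ball, dist_eq_norm] at this
      obtain ⟨y, hy, hxy⟩ := this
      have h1 : E n (T x) = E n (T x - y) + E n y := by simp
      calc ‖(E n ∘L T) x‖ = ‖E n (T x - y) + E n y‖ := by rw [← h1]; rfl
        _ ≤ ‖E n (T x - y)‖ + ‖E n y‖ := norm_add_le _ _
        _ ≤ C * δ + δ := add_le_add
            (((E n).le_opNorm _).trans (mul_le_mul (hC n) hxy.le (norm_nonneg _) hC0))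
            (hN n hn.le y hy).le
        _ = (C + 1) * δ := by ring
    have h2 : (C + 1) * δ = ε / 2 := by rw [hδ]; field_simp
    rw [Real.dist_0_eq_abs, abs_of_nonneg (norm_nonneg _)]
    linarith
  refine squeeze_zero (fun _ => norm_nonneg _) (fun n => ?_) (by simpa using hET.mul_const C)
  calc ‖E n ∘L T ∘L E n‖ = ‖(E n ∘L T) ∘L E n‖ := rfl
    _ ≤ ‖E n ∘L T‖ * ‖E n‖ := ContinuousLinearMap.opNorm_comp_le _ _
    _ ≤ ‖E n ∘L T‖ * C := mul_le_mul_of_nonneg_left (hC n) (norm_nonneg _)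
end

section
/- Let X be a Banach space, let T : X → X be a compact continuous linear operator such that I + T is bijective, and let (π_n) be a sequence of continuous linear operators on X with π_n x → x for every x ∈ X. Define T_n^M = π_n T π_n + π_n T (I − π_n) + (I − π_n) T π_n. Then there exist N ∈ ℕ and a constant C such that for all n ≥ N the operator I + T_n^M is bijective with continuous inverse and ‖(I + T_n^M)^{−1}‖ ≤ C. In particular, for every f ∈ X and n ≥ N the equation (I + T_n^M)u = f has a unique solution. -/
open ContinuousLinearMap Filter

theorem aux_tendsto {X : Type*} [NormedAddCommGroup X] [NormedSpace ℝ X]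
    (T : X →L[ℝ] X) (hT : IsCompactOperator T) (P : ℕ → X →L[ℝ] X)
    (hP : ∀ x : X, Tendsto (fun n => P n x) atTop (nhds 0)) (B : ℝ) (hB : ∀ n, ‖P n‖ ≤ B) :
    Tendsto (fun n => P n ∘L T) atTop (nhds 0) := by
  have hB0 : 0 ≤ B := (norm_nonneg _).trans (hB 0)
  obtain ⟨K, hK, hTK⟩ := IsCompactOperator.image_closedBall_subset_compact (𝕜₁ := ℝ) (𝕜₂ := ℝ)
    (f := (T : X →ₗ[ℝ] X)) hT 1
  rw [Metric.tendsto_atTop]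
  intro ε hε
  set δ := ε / (2 * (B + 1)) with hδ
  have hδ0 : 0 < δ := by positivity
  have hδe : (B + 1) * δ = ε / 2 := by rw [hδ]; field_simp
  obtain ⟨t, ht, hKt⟩ := Metric.totallyBounded_iff.1 hK.totallyBounded δ hδ0
  have hev : ∀ᶠ n in atTop, ∀ y ∈ t, ‖P n y‖ < δ := by
    rw [eventually_all_finite ht]
    intro y _
    have := (hP y).norm
    rw [norm_zero] at this
    exact this.eventually_lt_const hδ0
  obtain ⟨N, hN⟩ := eventually_atTop.1 hev
  refine ⟨N, fun n hn => ?_⟩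
  rw [dist_zero_right]
  have : ‖P n ∘L T‖ ≤ ε / 2 := by
    refine ContinuousLinearMap.opNorm_le_of_unit_norm (by positivity) fun x hx => ?_
    have hxK : T x ∈ K := hTK ⟨x, by simp [hx], rfl⟩
    obtain ⟨y, hy, hxy⟩ := Set.mem_iUnion₂.1 (hKt hxK)
    rw [Metric.mem_ball, dist_eq_norm] at hxy
    have h1 : P n (T x) = P n (T x - y) + P n y := by simp
    have h2 : ‖P n (T x - y)‖ ≤ B * δ :=
      (P n).le_of_opNorm_le_of_le (hB n) hxy.le
    have h3 := hN n hn y hy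
    calc ‖P n (T x)‖ ≤ ‖P n (T x - y)‖ + ‖P n y‖ := by rw [h1]; exact norm_add_le _ _
      _ ≤ ε / 2 := by linarith
  linarith

/-- If `X` is Banach, `T` compact with `I + T` bijective, and `π_n → I` pointwise, then
for all large `n` the operator `I + T_n^M` is bijective with continuous inverse whose
norm is uniformly bounded; in particular `(I + T_n^M)u = f` is uniquely solvable. -/
theorem modifiedProj_uniform_invertibility {X : Type*} [NormedAddCommGroup X]
    [NormedSpace ℝ X] [CompleteSpace X]
    (T : X →L[ℝ] X) (hT : IsCompactOperator T)
    (hbij : Function.Bijective (ContinuousLinearMap.id ℝ X + T))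
    (π : ℕ → X →L[ℝ] X)
    (hπ : ∀ x : X, Tendsto (fun n => π n x) atTop (nhds x)) :
    ∃ (N : ℕ) (C : ℝ), ∀ n ≥ N,
      Function.Bijective (ContinuousLinearMap.id ℝ X + modifiedProj T (π n)) ∧
      (∃ S : X →L[ℝ] X,
        S ∘L (ContinuousLinearMap.id ℝ X + modifiedProj T (π n)) =
          ContinuousLinearMap.id ℝ X ∧
        (ContinuousLinearMap.id ℝ X + modifiedProj T (π n)) ∘L S =
          ContinuousLinearMap.id ℝ X ∧
        ‖S‖ ≤ C) ∧
      ∀ f : X, ∃! u : X, (ContinuousLinearMap.id ℝ X + modifiedProj T (π n)) u = f := by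
  let P : ℕ → X →L[ℝ] X := fun n => ContinuousLinearMap.id ℝ X - π n
  have hP : ∀ x : X, Tendsto (fun n => P n x) atTop (nhds 0) := by
    intro x
    simpa [P] using (tendsto_const_nhds (x := x)).sub (hπ x)
  obtain ⟨B, hB⟩ := banach_steinhaus (g := P) (fun x => by
    obtain ⟨C, hC⟩ := (hP x).norm.bddAbove_range
    exact ⟨C, fun n => hC ⟨n, rfl⟩⟩)
  have hB0 : 0 ≤ B := (norm_nonneg _).trans (hB 0)
  have h1 := aux_tendsto T hT P hP B hB
  have h2 : Tendsto (fun n => (P n ∘L T) ∘L P n) atTop (nhds 0) := by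
    have h3 : Tendsto (fun n => ‖P n ∘L T‖ * B) atTop (nhds 0) := by
      simpa using h1.norm.mul_const B
    refine squeeze_zero_norm (fun n => ?_) h3
    exact (ContinuousLinearMap.opNorm_comp_le _ _).trans
      (mul_le_mul_of_nonneg_left (hB n) (norm_nonneg _))
  have heq : ∀ n, ContinuousLinearMap.id ℝ X + modifiedProj T (π n) =
      (ContinuousLinearMap.id ℝ X + T) - (P n ∘L T) ∘L P n := by
    intro n
    ext x
    simp [modifiedProj, P]
    abel
  have h4 : Tendsto (fun n => ContinuousLinearMap.id ℝ X + modifiedProj T (π n)) atTop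
      (nhds (ContinuousLinearMap.id ℝ X + T)) := by
    simp_rw [heq]
    simpa using (tendsto_const_nhds (x := ContinuousLinearMap.id ℝ X + T)).sub h2
  obtain ⟨u, hu⟩ := ContinuousLinearMap.isUnit_iff_bijective.2 hbij
  rw [← hu] at h4
  have h5 := h4.eventually (Units.isOpen.mem_nhds u.isUnit)
  have h6 := ((NormedRing.inverse_continuousAt u).tendsto.comp h4).norm.eventually_lt_const
    (lt_add_one _)
  obtain ⟨N, hN⟩ := eventually_atTop.1 (h5.and h6)
  refine ⟨N, ‖Ring.inverse (u : X →L[ℝ] X)‖ + 1, fun n hn => ?_⟩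
  obtain ⟨hunit, hnorm⟩ := hN n hn
  have hb := ContinuousLinearMap.isUnit_iff_bijective.1 hunit
  exact ⟨hb, ⟨Ring.inverse _, Ring.inverse_mul_cancel _ hunit, Ring.mul_inverse_cancel _ hunit,
    hnorm.le⟩, fun f => hb.existsUnique f⟩
end

section
/- Let X be a Banach space, T : X → X a continuous linear operator, and π a continuous linear operator on X such that both I + T and I + T^M are bijective, where T^M = πTπ + πT(I−π) + (I−π)Tπ. Given f ∈ X, let u = (I+T)^{−1} f, let u^M = (I+T^M)^{−1} f, and define the iterated modified projection solution ũ^M = f − T u^M. Then ũ^M − u = T(u − u^M) = −T(I + T^M)^{−1}(I − π)T(I − π)u. -/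
open ContinuousLinearMap

/-- Error representation for the iterated modified projection solution: if `I + T` and
`I + T^M` are bijective (the latter with continuous inverse `S`), `u` solves `(I+T)u = f`,
`u^M` solves `(I+T^M)u^M = f`, and `ũ^M = f − T u^M`, then
`ũ^M − u = T(u − u^M) = −T(I + T^M)⁻¹(I − π)T(I − π)u`. -/
theorem iterated_modifiedProj_solution_error {X : Type*} [NormedAddCommGroup X]
    [NormedSpace ℝ X] [CompleteSpace X]
    (T π : X →L[ℝ] X)
    (hT : Function.Bijective (ContinuousLinearMap.id ℝ X + T))
    (hTM : Function.Bijective (ContinuousLinearMap.id ℝ X + modifiedProj T π))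
    (S : X →L[ℝ] X)
    (hS1 : S ∘L (ContinuousLinearMap.id ℝ X + modifiedProj T π) =
      ContinuousLinearMap.id ℝ X)
    (hS2 : (ContinuousLinearMap.id ℝ X + modifiedProj T π) ∘L S =
      ContinuousLinearMap.id ℝ X)
    (f u uM : X)
    (hu : (ContinuousLinearMap.id ℝ X + T) u = f)
    (huM : (ContinuousLinearMap.id ℝ X + modifiedProj T π) uM = f) :
    (f - T uM) - u = T (u - uM) ∧
    (f - T uM) - u = -(T (S ((ContinuousLinearMap.id ℝ X - π)
      (T ((ContinuousLinearMap.id ℝ X - π) u))))) := by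
  have h1 : (f - T uM) - u = T (u - uM) := by
    rw [← hu]
    simp only [add_apply, ContinuousLinearMap.id_apply, map_sub]
    abel
  refine ⟨h1, ?_⟩
  have h2 : (ContinuousLinearMap.id ℝ X - π) (T ((ContinuousLinearMap.id ℝ X - π) u)) =
      (ContinuousLinearMap.id ℝ X + modifiedProj T π) (uM - u) := by
    rw [map_sub, huM, ← hu]
    simp only [modifiedProj, add_apply, sub_apply, ContinuousLinearMap.id_apply, map_sub,
      ContinuousLinearMap.comp_apply]
    abel
  have h3 : S ((ContinuousLinearMap.id ℝ X + modifiedProj T π) (uM - u)) = uM - u := by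
    have := congrArg (fun A : X →L[ℝ] X => A (uM - u)) hS1
    exact this
  rw [h1, h2, h3, ← map_neg, neg_sub]
end

section
/- Let X be a Banach space, let T : X → X be a compact continuous linear operator such that I + T is bijective, and let (π_n) be a sequence of continuous linear operators on X with π_n x → x for every x ∈ X. Define T_n^M = π_n T π_n + π_n T (I − π_n) + (I − π_n) T π_n. Then there exist N ∈ ℕ and a constant C such that for every f ∈ X and every n ≥ N, the solutions u = (I+T)^{−1} f and u_n^M = (I+T_n^M)^{−1} f satisfy ‖u − u_n^M‖ ≤ C·‖(I − π_n)T(I − π_n)u‖. -/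
open ContinuousLinearMap Filter

/-- Pointwise null sequences of operators converge to zero in norm after composing with a
compact operator. -/
theorem tendsto_comp_compact_zero {X : Type*} [NormedAddCommGroup X]
    [NormedSpace ℝ X] [CompleteSpace X]
    (T : X →L[ℝ] X) (hT : IsCompactOperator T) (D : ℕ → X →L[ℝ] X) (M : ℝ)
    (hM : ∀ n, ‖D n‖ ≤ M)
    (hD : ∀ x : X, Tendsto (fun n => D n x) atTop (nhds 0)) :
    Tendsto (fun n => D n ∘L T) atTop (nhds 0) := by
  have hM0 : 0 ≤ M := (norm_nonneg _).trans (hM 0)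
  obtain ⟨K, hK, hTK⟩ := IsCompactOperator.image_closedBall_subset_compact (f := (T : X →ₗ[ℝ] X)) hT 1
  rw [Metric.tendsto_atTop]
  intro ε hε
  have hδ : 0 < ε / (4 * (M + 1)) := by positivity
  obtain ⟨t, -, htf, hcov⟩ := hK.finite_cover_balls hδ
  have h1 : ∀ᶠ n in atTop, ∀ y ∈ t, ‖D n y‖ < ε / 4 := by
    rw [eventually_all_finite htf]
    intro y _
    have := (hD y).norm
    rw [norm_zero] at this
    exact this.eventually (gt_mem_nhds (by positivity))
  obtain ⟨N, hN⟩ := eventually_atTop.1 h1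
  refine ⟨N, fun n hn => ?_⟩
  rw [dist_zero_right]
  refine lt_of_le_of_lt (ContinuousLinearMap.opNorm_le_of_unit_norm (C := ε / 2) (by positivity) ?_)
    (half_lt_self hε)
  intro x hx
  have hxK : T x ∈ K := hTK ⟨x, by simp [hx], rfl⟩
  have := hcov hxK
  simp only [Set.mem_iUnion, Metric.mem_ball, exists_prop] at this
  obtain ⟨y, hy, hxy⟩ := this
  rw [dist_eq_norm] at hxy
  have e : D n (T x) = D n (T x - y) + D n y := by simp
  have h2 : ‖D n (T x - y)‖ ≤ M * (ε / (4 * (M + 1))) :=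
    ((D n).le_opNorm _).trans (mul_le_mul (hM n) hxy.le (norm_nonneg _) hM0)
  have h3 : M * (ε / (4 * (M + 1))) ≤ ε / 4 := by
    rw [← mul_div_assoc, div_le_div_iff₀ (by positivity) (by positivity)]
    nlinarith
  have h4 := hN n hn y hy
  have h5 := norm_add_le (D n (T x - y)) (D n y)
  rw [← e] at h5
  change ‖D n (T x)‖ ≤ ε / 2
  linarith

/-- If `X` is Banach, `T` compact with `I + T` bijective, and `π_n → I` pointwise, then
there exist `N` and `C` such that for all `n ≥ N`, `I + T_n^M` is bijective and the
solutions `u` of `(I+T)u = f` and `u_n^M` of `(I+T_n^M)u_n^M = f` satisfy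
`‖u − u_n^M‖ ≤ C·‖(I − π_n)T(I − π_n)u‖`. -/
theorem modifiedProj_solution_bound {X : Type*} [NormedAddCommGroup X]
    [NormedSpace ℝ X] [CompleteSpace X]
    (T : X →L[ℝ] X) (hT : IsCompactOperator T)
    (hbij : Function.Bijective (ContinuousLinearMap.id ℝ X + T))
    (π : ℕ → X →L[ℝ] X)
    (hπ : ∀ x : X, Tendsto (fun n => π n x) atTop (nhds x)) :
    ∃ (N : ℕ) (C : ℝ), ∀ n ≥ N,
      Function.Bijective (ContinuousLinearMap.id ℝ X + modifiedProj T (π n)) ∧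
      ∀ f u uM : X,
        (ContinuousLinearMap.id ℝ X + T) u = f →
        (ContinuousLinearMap.id ℝ X + modifiedProj T (π n)) uM = f →
        ‖u - uM‖ ≤ C * ‖(ContinuousLinearMap.id ℝ X - π n)
          (T ((ContinuousLinearMap.id ℝ X - π n) u))‖ := by
  have hD : ∀ x : X, Tendsto (fun n => (ContinuousLinearMap.id ℝ X - π n) x) atTop (nhds 0) := by
    intro x
    simpa using (tendsto_const_nhds (x := x)).sub (hπ x)
  obtain ⟨M, hM⟩ : ∃ M, ∀ n, ‖ContinuousLinearMap.id ℝ X - π n‖ ≤ M := by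
    apply banach_steinhaus
    intro x
    obtain ⟨C, hC⟩ := (hD x).norm.bddAbove_range
    exact ⟨C, fun n => hC ⟨n, rfl⟩⟩
  have h0 := tendsto_comp_compact_zero T hT _ M hM hD
  have hmod : ∀ n, ContinuousLinearMap.id ℝ X + modifiedProj T (π n) =
      (ContinuousLinearMap.id ℝ X + T) -
      ((ContinuousLinearMap.id ℝ X - π n) ∘L T) ∘L (ContinuousLinearMap.id ℝ X - π n) := by
    intro n
    ext x
    simp [modifiedProj]
    abel
  have hE : Tendsto (fun n => ((ContinuousLinearMap.id ℝ X - π n) ∘L T) ∘L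
      (ContinuousLinearMap.id ℝ X - π n)) atTop (nhds 0) := by
    have h1 := h0.norm.mul_const M
    rw [norm_zero, zero_mul] at h1
    refine squeeze_zero_norm (fun n => ?_) h1
    exact (ContinuousLinearMap.opNorm_comp_le _ _).trans
      (mul_le_mul_of_nonneg_left (hM n) (norm_nonneg _))
  have hA : IsUnit (ContinuousLinearMap.id ℝ X + T) :=
    ContinuousLinearMap.isUnit_iff_bijective.2 hbij
  have hlim : Tendsto (fun n => ContinuousLinearMap.id ℝ X + modifiedProj T (π n)) atTop
      (nhds (ContinuousLinearMap.id ℝ X + T)) := by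
    simp_rw [hmod]
    simpa using (tendsto_const_nhds (x := ContinuousLinearMap.id ℝ X + T)).sub hE
  obtain ⟨A, hA⟩ := hA
  rw [← hA] at hlim
  have hunit := hlim.eventually (Units.nhds A)
  have hinv := ((NormedRing.inverse_continuousAt A).tendsto.comp hlim).norm.eventually
    (gt_mem_nhds (lt_add_one _))
  obtain ⟨N, hN⟩ := eventually_atTop.1 (hunit.and hinv)
  refine ⟨N, ‖Ring.inverse (A : X →L[ℝ] X)‖ + 1, fun n hn => ⟨ContinuousLinearMap.isUnit_iff_bijective.1 (hN n hn).1, ?_⟩⟩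
  intro f u uM hu huM
  obtain ⟨hU, hI⟩ := hN n hn
  set B := ContinuousLinearMap.id ℝ X + modifiedProj T (π n) with hB
  have key : B (uM - u) = (ContinuousLinearMap.id ℝ X - π n)
      (T ((ContinuousLinearMap.id ℝ X - π n) u)) := by
    rw [map_sub, huM, hB, hmod n, _root_.sub_apply, hu]
    simp
    abel
  have h1 : Ring.inverse B (B (uM - u)) = uM - u := by
    have := Ring.inverse_mul_cancel B hU
    exact congrArg (fun L : X →L[ℝ] X => L (uM - u)) this
  rw [← key, norm_sub_rev]
  calc ‖uM - u‖ = ‖Ring.inverse B (B (uM - u))‖ := by rw [h1]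
    _ ≤ ‖Ring.inverse B‖ * ‖B (uM - u)‖ := ContinuousLinearMap.le_opNorm _ _
    _ ≤ _ := mul_le_mul_of_nonneg_right hI.le (norm_nonneg _)
end

section
/- Fix p ∈ (0,1), α with 0 < α < 1/(1+p), and a grading exponent q > 2/α. For each n ≥ 1 let π_h be the piecewise-constant mean-value projection on the graded mesh with nodes t_i = (i/n)^q. Then there is a constant C, independent of n and u, such that for every u ∈ C¹_α, sup_{x ∈ (0,1]} |(K(I − π_h)u)(x)| ≤ C·n^{−2}·‖u‖_{1,α}. -/
open MeasureTheory Real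

/-- The double-layer corner kernel
`k(x,y) = (sin(pπ)/π)·x/(x² + y² + 2xy·cos(pπ))` for a corner of interior angle
`(1−p)π`. -/
noncomputable def cornerKernel (p x y : ℝ) : ℝ :=
  Real.sin (p * Real.pi) / Real.pi * x / (x ^ 2 + y ^ 2 + 2 * x * y * Real.cos (p * Real.pi))

/-- The corner operator `(Ku)(x) = ∫₀¹ k(x,y)·u(y) dy`. -/
noncomputable def cornerOp (p : ℝ) (u : ℝ → ℝ) (x : ℝ) : ℝ :=
  ∫ y in Set.Ioc (0 : ℝ) 1, cornerKernel p x y * u y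

/-- Node `t_i = (i/n)^q` of the graded mesh on `[0,1]` with grading exponent `q`. -/
noncomputable def gradedNode (n : ℕ) (q : ℝ) (i : ℕ) : ℝ :=
  ((i : ℝ) / (n : ℝ)) ^ q

/-- The piecewise-constant mean-value (Galerkin) projection `π_h` on the graded mesh:
on each subinterval `τ_i = (t_{i−1}, t_i]` the function is replaced by its mean value. -/
noncomputable def gradedProj (n : ℕ) (q : ℝ) (u : ℝ → ℝ) (x : ℝ) : ℝ :=
  ∑ i ∈ Finset.Icc 1 n,
    Set.indicator (Set.Ioc (gradedNode n q (i - 1)) (gradedNode n q i))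
      (fun _ => (gradedNode n q i - gradedNode n q (i - 1))⁻¹ *
        ∫ y in Set.Ioc (gradedNode n q (i - 1)) (gradedNode n q i), u y) x

/-- The set of weighted values whose supremum is the weighted norm
`‖u‖_{m,α} = max_{0≤i≤m} sup_{t∈(0,1]} t^{max(i−α,0)}·|u^{(i)}(t)|`, with derivatives
taken within `(0,1]`. -/
def weightedSet (m : ℕ) (α : ℝ) (u : ℝ → ℝ) : Set ℝ :=
  {r : ℝ | ∃ i ≤ m, ∃ t ∈ Set.Ioc (0 : ℝ) 1,
    r = t ^ max ((i : ℝ) - α) 0 * |iteratedDerivWithin i u (Set.Ioc 0 1) t|}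

/-- The weighted norm `‖u‖_{m,α}`. -/
noncomputable def weightedNorm (m : ℕ) (α : ℝ) (u : ℝ → ℝ) : ℝ :=
  sSup (weightedSet m α u)

/-- `K(I − π_h)u`, the corner operator applied to the projection error of `u`. -/
noncomputable def cornerErr (p q : ℝ) (n : ℕ) (u : ℝ → ℝ) : ℝ → ℝ :=
  fun x => cornerOp p (fun y => u y - gradedProj n q u y) x

open Set intervalIntegral

lemma aux_norm_bounds {α : ℝ} (hα0 : 0 < α) (hα1 : α < 1) {u : ℝ → ℝ}
    (hb : BddAbove (weightedSet 1 α u)) :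
    (∀ t ∈ Set.Ioc (0:ℝ) 1, |u t| ≤ weightedNorm 1 α u) ∧
    (∀ t ∈ Set.Ioc (0:ℝ) 1, |derivWithin u (Set.Ioc 0 1) t| ≤ weightedNorm 1 α u * t ^ (α - 1)) := by
  constructor
  · intro t ht
    apply le_csSup hb
    refine ⟨0, by norm_num, t, ht, ?_⟩
    rw [iteratedDerivWithin_zero, Nat.cast_zero, max_eq_right (by linarith), Real.rpow_zero, one_mul]
  · intro t ht
    have h : t ^ (1 - α) * |derivWithin u (Set.Ioc 0 1) t| ≤ weightedNorm 1 α u := by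
      apply le_csSup hb
      refine ⟨1, le_rfl, t, ht, ?_⟩
      rw [iteratedDerivWithin_one, Nat.cast_one, max_eq_left (by linarith)]
    have h1 : t ^ (1 - α) * t ^ (α - 1) = 1 := by
      rw [← Real.rpow_add ht.1]; simp
    have h2 : 0 < t ^ (α - 1) := Real.rpow_pos_of_pos ht.1 _
    calc |derivWithin u (Set.Ioc 0 1) t|
        = (t ^ (1 - α) * |derivWithin u (Set.Ioc 0 1) t|) * t ^ (α - 1) := by
          rw [mul_right_comm, h1, one_mul]
      _ ≤ _ := by gcongr

lemma aux_osc_le {α : ℝ} (hα0 : 0 < α) {u : ℝ → ℝ} {M : ℝ}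
    (hu : ContDiffOn ℝ 1 u (Set.Ioc 0 1))
    (hd : ∀ t ∈ Set.Ioc (0:ℝ) 1, |derivWithin u (Set.Ioc 0 1) t| ≤ M * t ^ (α - 1))
    {z y : ℝ} (hz : 0 < z) (hzy : z ≤ y) (hy : y ≤ 1) :
    |u y - u z| ≤ M / α * (y ^ α - z ^ α) := by
  have hsub : Set.Icc z y ⊆ Set.Ioc 0 1 := fun t ht => ⟨lt_of_lt_of_le hz ht.1, ht.2.trans hy⟩
  have key := image_norm_le_of_norm_deriv_right_le_deriv_boundary'
    (f := fun t => u t - u z) (f' := fun t => derivWithin u (Set.Ioc 0 1) t) (a := z) (b := y)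
    (B := fun t => M / α * (t ^ α - z ^ α)) (B' := fun t => M * t ^ (α - 1))
    ((hu.continuousOn.mono hsub).sub continuousOn_const) ?_ (by simp) ?_ ?_ ?_
    (x := y) ⟨hzy, le_rfl⟩
  · simpa using key
  · intro t ht
    have h1 : t ∈ Set.Ioc (0:ℝ) 1 := hsub ⟨ht.1, ht.2.le⟩
    have h2 := ((hu.differentiableOn one_ne_zero) t h1).hasDerivWithinAt
    have h3 : Set.Ioc (0:ℝ) 1 ∈ nhds t := Ioc_mem_nhds h1.1 (lt_of_lt_of_le ht.2 hy)
    exact ((h2.hasDerivAt h3).sub_const _).hasDerivWithinAt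
  · intro t ht
    have : t ≠ 0 := (lt_of_lt_of_le hz ht.1).ne'
    exact (continuousAt_const.mul ((Real.continuousAt_rpow_const t α (Or.inl this)).sub
      continuousAt_const)).continuousWithinAt
  · intro t ht
    have : t ≠ 0 := (lt_of_lt_of_le hz ht.1).ne'
    have h := ((Real.hasDerivAt_rpow_const (p := α) (Or.inl this)).sub_const (z ^ α)).const_mul (M / α)
    refine (h.congr_deriv ?_).hasDerivWithinAt
    field_simp
  · intro t ht
    exact hd t (hsub ⟨ht.1, ht.2.le⟩)

lemma aux_bernoulli {r : ℝ} (hr : 1 ≤ r) {n : ℕ} (hn : 1 ≤ n) (j : ℕ) :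
    (((j + 1 : ℕ) : ℝ) / n) ^ r - ((j : ℝ) / n) ^ r ≤
      r / ((j:ℝ) + 1) * ((((j + 1 : ℕ) : ℝ)) / n) ^ r := by
  have hn' : (0:ℝ) < n := by exact_mod_cast hn
  have hj : (0:ℝ) < (j:ℝ) + 1 := by positivity
  have h := one_add_mul_self_le_rpow_one_add (s := -(1 / ((j:ℝ) + 1))) ?_ hr
  · have e : (j : ℝ) / n = (1 + -(1 / ((j:ℝ) + 1))) * (((j + 1 : ℕ) : ℝ) / n) := by
      push_cast; field_simp; ring
    have h0 : 0 ≤ 1 + -(1 / ((j:ℝ) + 1)) := by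
      have : 1 / ((j:ℝ) + 1) ≤ 1 := by rw [div_le_one hj]; linarith [Nat.cast_nonneg (α := ℝ) j]
      linarith
    have hp : 0 ≤ ((((j + 1 : ℕ) : ℝ)) / n) ^ r := by positivity
    rw [e, Real.mul_rpow h0 (by positivity)]
    have := mul_le_mul_of_nonneg_right h hp
    have e2 : r / ((j:ℝ) + 1) = r * (1 / ((j:ℝ) + 1)) := by ring
    rw [e2]; nlinarith
  · have : 1 / ((j:ℝ) + 1) ≤ 1 := by rw [div_le_one hj]; linarith [Nat.cast_nonneg (α := ℝ) j]
    linarith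

lemma aux_den_ge {c x y : ℝ} (hx : 0 ≤ x) (hy : 0 ≤ y) :
    (1 - |c|) * (x ^ 2 + y ^ 2) ≤ x ^ 2 + y ^ 2 + 2 * x * y * c := by
  have h1 : -|c| ≤ c := neg_abs_le c
  have h2 : 0 ≤ |c| := abs_nonneg c
  nlinarith [mul_nonneg hx hy, mul_nonneg h2 (sq_nonneg (x - y)),
    mul_le_mul_of_nonneg_left h1 (mul_nonneg hx hy)]

lemma aux_abs_cos {p : ℝ} (hp0 : 0 < p) (hp1 : p < 1) : |Real.cos (p * Real.pi)| < 1 := by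
  have hs : 0 < Real.sin (p * Real.pi) := by
    apply Real.sin_pos_of_pos_of_lt_pi
    · positivity
    · nlinarith [Real.pi_pos]
  rw [← sq_lt_one_iff_abs_lt_one]
  nlinarith [Real.sin_sq_add_cos_sq (p * Real.pi)]

lemma aux_ker_diff {p : ℝ} (hp0 : 0 < p) (hp1 : p < 1) {x y b h : ℝ} (hx : 0 < x) (hy : 0 ≤ y)
    (hyb : y ≤ b) (hb : 0 < b) (hh : b - y ≤ h) :
    |cornerKernel p x y - cornerKernel p x b| ≤
      4 / (1 - |Real.cos (p * Real.pi)|) ^ 2 * (h / b) * (x / (x ^ 2 + y ^ 2)) := by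
  have hc := aux_abs_cos hp0 hp1
  unfold cornerKernel
  set c := Real.cos (p * Real.pi)
  set s := Real.sin (p * Real.pi) / Real.pi with hs
  have hs1 : |s| ≤ 1 := by
    rw [hs, abs_div, abs_of_pos Real.pi_pos, div_le_one Real.pi_pos]
    linarith [Real.abs_sin_le_one (p * Real.pi), Real.pi_gt_three]
  have hd0 : 0 < 1 - |c| := by linarith
  set d := 1 - |c| with hd
  have hDy := aux_den_ge (c := c) hx.le hy
  have hDb := aux_den_ge (c := c) hx.le hb.le
  rw [← hd] at hDy hDb
  set Dy := x ^ 2 + y ^ 2 + 2 * x * y * c with hDyd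
  set Db := x ^ 2 + b ^ 2 + 2 * x * b * c with hDbd
  have hy2 : 0 < d * (x ^ 2 + y ^ 2) := by positivity
  have hDy0 : 0 < Dy := by linarith
  have hb2 : d / 2 * (x + b) ^ 2 ≤ Db := by nlinarith [mul_nonneg hd0.le (sq_nonneg (x - b))]
  have hb3 : 0 < d / 2 * (x + b) ^ 2 := by positivity
  have hDb0 : 0 < Db := by linarith
  have hh0 : 0 ≤ h := by linarith
  have e : s * x / Dy - s * x / Db = s * (x * ((b - y) * (b + y + 2 * x * c)) / (Dy * Db)) := by
    rw [div_sub_div _ _ hDy0.ne' hDb0.ne', ← mul_div_assoc]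
    congr 1
    rw [hDyd, hDbd]; ring
  rw [e, abs_mul s, abs_div (x * _), abs_mul, abs_mul, abs_of_pos hx, abs_of_nonneg (by linarith : 0 ≤ b - y),
    abs_of_pos (mul_pos hDy0 hDb0)]
  have h5 : |b + y + 2 * x * c| ≤ 2 * (x + b) := by
    have := abs_lt.1 hc
    rw [abs_le]; constructor <;> nlinarith
  calc |s| * (x * ((b - y) * |b + y + 2 * x * c|) / (Dy * Db))
      ≤ 1 * (x * (h * (2 * (x + b))) / ((d * (x ^ 2 + y ^ 2)) * (d / 2 * (x + b) ^ 2))) := by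
        gcongr
    _ = 4 / d ^ 2 * (h / (x + b)) * (x / (x ^ 2 + y ^ 2)) := by
        field_simp; norm_num
    _ ≤ _ := by
        gcongr
        linarith

lemma aux_int_le {x : ℝ} (hx : 0 < x) :
    ∫ y in (0:ℝ)..1, x / (x ^ 2 + y ^ 2) ≤ Real.pi / 2 := by
  have hcont : Continuous fun y : ℝ => x / (x ^ 2 + y ^ 2) := by
    apply continuous_const.div (by fun_prop)
    intro y; positivity
  rw [integral_eq_sub_of_hasDerivAt (f := fun y => Real.arctan (y / x)) (fun y _ => ?_)
    (hcont.intervalIntegrable _ _)]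
  · simp; exact (Real.arctan_lt_pi_div_two _).le
  · have := ((hasDerivAt_id y).div_const x).arctan
    refine this.congr_deriv ?_
    simp
    field_simp

/-- Estimate on one cell. -/
lemma aux_cell {p : ℝ} (hp0 : 0 < p) (hp1 : p < 1) {x a b E : ℝ} (hx : 0 < x) (ha : 0 ≤ a)
    (hab : a < b) {u : ℝ → ℝ} (hu : IntervalIntegrable u volume a b)
    (hE : ∀ y ∈ Set.Ioc a b, ∀ z ∈ Set.Ioc a b, |u y - u z| ≤ E) :
    IntervalIntegrable (fun y => cornerKernel p x y * (u y - (b - a)⁻¹ * ∫ z in a..b, u z)) volume a b ∧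
    |∫ y in a..b, cornerKernel p x y * (u y - (b - a)⁻¹ * ∫ z in a..b, u z)| ≤
      4 / (1 - |Real.cos (p * Real.pi)|) ^ 2 * ((b - a) / b) * E * ∫ y in a..b, x / (x ^ 2 + y ^ 2) := by
  have hc := aux_abs_cos hp0 hp1
  have hh : 0 < b - a := by linarith
  have hb : 0 < b := by linarith
  set m := (b - a)⁻¹ * ∫ z in a..b, u z with hm
  have he : IntervalIntegrable (fun y => u y - m) volume a b := hu.sub intervalIntegrable_const
  have hmean : ∫ y in a..b, (u y - m) = 0 := by
    rw [intervalIntegral.integral_sub hu intervalIntegrable_const, intervalIntegral.integral_const, smul_eq_mul, hm]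
    field_simp; ring
  have hcont : ContinuousOn (fun y => cornerKernel p x y) (Set.uIcc a b) := by
    unfold cornerKernel
    apply ContinuousOn.div (by fun_prop) (by fun_prop)
    intro y hy
    rw [Set.uIcc_of_le hab.le] at hy
    have := aux_den_ge (c := Real.cos (p * Real.pi)) hx.le (ha.trans hy.1)
    have h2 : 0 < (1 - |Real.cos (p * Real.pi)|) * (x ^ 2 + y ^ 2) := by
      have : 0 < 1 - |Real.cos (p * Real.pi)| := by linarith
      positivity
    linarith
  have hint := he.continuousOn_mul hcont
  refine ⟨hint, ?_⟩
  have hpt : ∀ y ∈ Set.Ioc a b, |u y - m| ≤ E := by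
    intro y hy
    have e1 : u y - m = (b - a)⁻¹ * ∫ z in a..b, (u y - u z) := by
      rw [intervalIntegral.integral_sub intervalIntegrable_const hu, intervalIntegral.integral_const, smul_eq_mul, hm]
      field_simp
    have h2 : ‖∫ z in a..b, (u y - u z)‖ ≤ E * |b - a| := by
      apply intervalIntegral.norm_integral_le_of_norm_le_const
      intro z hz
      rw [Set.uIoc_of_le hab.le] at hz
      exact hE y hy z hz
    rw [abs_of_pos hh, Real.norm_eq_abs] at h2
    rw [e1, abs_mul, abs_of_pos (inv_pos.2 hh), inv_mul_le_iff₀ hh]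
    linarith
  have e2 : ∫ y in a..b, cornerKernel p x y * (u y - m) =
      ∫ y in a..b, (cornerKernel p x y - cornerKernel p x b) * (u y - m) := by
    have : ∀ y, (cornerKernel p x y - cornerKernel p x b) * (u y - m) =
      cornerKernel p x y * (u y - m) - cornerKernel p x b * (u y - m) := fun y => by ring
    simp_rw [this]
    rw [intervalIntegral.integral_sub hint (he.const_mul _), intervalIntegral.integral_const_mul, hmean]; simp
  have hcont2 : Continuous fun y : ℝ => x / (x ^ 2 + y ^ 2) := by
    apply continuous_const.div (by fun_prop)
    intro y; positivity
  rw [e2, ← intervalIntegral.integral_const_mul, ← Real.norm_eq_abs]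
  apply intervalIntegral.norm_integral_le_of_norm_le hab.le
  · refine Filter.Eventually.of_forall fun y hy => ?_
    have h1 := aux_ker_diff hp0 hp1 hx (ha.trans hy.1.le) hy.2 hb (by linarith [hy.1] : b - y ≤ b - a)
    have h2 := hpt y hy
    rw [Real.norm_eq_abs, abs_mul]
    calc _ ≤ (4 / (1 - |Real.cos (p * Real.pi)|) ^ 2 * ((b - a) / b) * (x / (x ^ 2 + y ^ 2))) * E :=
          mul_le_mul h1 h2 (abs_nonneg _) ((abs_nonneg _).trans h1)
      _ = _ := by ring
  · exact (hcont2.intervalIntegrable _ _).const_mul _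

lemma aux_node_mono {n : ℕ} {q : ℝ} (hq : 0 < q) : Monotone (gradedNode n q) := by
  intro i j hij
  unfold gradedNode
  have : (i:ℝ) ≤ j := by exact_mod_cast hij
  gcongr

lemma aux_proj_eq {n : ℕ} {q : ℝ} (hq : 0 < q) (u : ℝ → ℝ) {j : ℕ} (hj : j < n) {y : ℝ}
    (hy : y ∈ Set.Ioc (gradedNode n q j) (gradedNode n q (j + 1))) :
    gradedProj n q u y = (gradedNode n q (j + 1) - gradedNode n q j)⁻¹ *
      ∫ z in (gradedNode n q j)..(gradedNode n q (j + 1)), u z := by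
  have hm := aux_node_mono (n := n) hq
  unfold gradedProj
  rw [Finset.sum_eq_single (j + 1)]
  · simp only [Nat.add_sub_cancel]
    rw [Set.indicator_of_mem hy, intervalIntegral.integral_of_le (hm (Nat.le_succ j))]
  · intro i hi hij
    apply Set.indicator_of_notMem
    intro hyi
    have hi1 := (Finset.mem_Icc.1 hi).1
    rcases lt_or_gt_of_ne hij with h | h
    · have := hm (show i ≤ j by omega)
      linarith [hyi.2, hy.1]
    · have := hm (show j + 1 ≤ i - 1 by omega)
      linarith [hyi.1, hy.2]
  · intro h
    exact absurd (Finset.mem_Icc.2 ⟨by omega, by omega⟩) h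

/-- For `p ∈ (0,1)`, `0 < α < 1/(1+p)` and grading exponent `q > 2/α`, there is a
constant `C > 0`, independent of `n` and `u`, such that for every `u ∈ C¹_α`,
`sup_{x∈(0,1]} |(K(I − π_h)u)(x)| ≤ C·n⁻²·‖u‖_{1,α}`. -/
theorem cornerErr_uniform_bound (p α q : ℝ)
    (hp0 : 0 < p) (hp1 : p < 1) (hα0 : 0 < α) (hα1 : α < 1 / (1 + p))
    (hq : q > 2 / α) :
    ∃ C : ℝ, 0 < C ∧ ∀ n : ℕ, 1 ≤ n → ∀ u : ℝ → ℝ,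
      ContDiffOn ℝ 1 u (Set.Ioc 0 1) → BddAbove (weightedSet 1 α u) →
      ∀ x ∈ Set.Ioc (0 : ℝ) 1,
        |cornerErr p q n u x| ≤ C * ((n : ℝ) ^ 2)⁻¹ * weightedNorm 1 α u := by
  have hα : α < 1 := hα1.trans_le (by rw [div_le_one (by linarith)]; linarith)
  have hqα : 2 < q * α := by rwa [gt_iff_lt, div_lt_iff₀ hα0] at hq
  have hq2 : 2 < q := by nlinarith
  have hq0 : 0 < q := by linarith
  have hd0 : 0 < 1 - |Real.cos (p * Real.pi)| := by linarith [aux_abs_cos hp0 hp1]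
  set A := 4 / (1 - |Real.cos (p * Real.pi)|) ^ 2 with hA
  have hA0 : 0 < A := by positivity
  refine ⟨A * q ^ 2 * (Real.pi / 2), by positivity, ?_⟩
  intro n hn u hu hb x hx
  obtain ⟨hM0, hM1⟩ := aux_norm_bounds hα0 hα hb
  set M := weightedNorm 1 α u
  have hM : 0 ≤ M := (abs_nonneg _).trans (hM0 1 (by simp))
  have hn' : (0:ℝ) < n := by exact_mod_cast hn
  have hmono := aux_node_mono (n := n) hq0
  have ht0 : gradedNode n q 0 = 0 := by simp [gradedNode, Real.zero_rpow hq0.ne']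
  have htn : gradedNode n q n = 1 := by simp [gradedNode, div_self hn'.ne']
  have htpos : ∀ j, 0 ≤ gradedNode n q j := fun j => by unfold gradedNode; positivity
  have htle : ∀ j, j ≤ n → gradedNode n q j ≤ 1 := fun j hj => htn ▸ hmono hj
  have hui : IntegrableOn u (Set.Ioc 0 1) volume := by
    refine Integrable.of_bound
      (hu.continuousOn.aestronglyMeasurable measurableSet_Ioc) M ?_
    exact (ae_restrict_iff' measurableSet_Ioc).2 (Filter.Eventually.of_forall fun t ht => hM0 t ht)
  have cell : ∀ j, j < n →
      IntervalIntegrable (fun y => cornerKernel p x y * (u y - gradedProj n q u y)) volume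
        (gradedNode n q j) (gradedNode n q (j + 1)) ∧
      |∫ y in (gradedNode n q j)..(gradedNode n q (j + 1)),
        cornerKernel p x y * (u y - gradedProj n q u y)| ≤
      A * q ^ 2 * ((n:ℝ) ^ 2)⁻¹ * M *
        ∫ y in (gradedNode n q j)..(gradedNode n q (j + 1)), x / (x ^ 2 + y ^ 2) := by
    intro j hj
    have hs0 : (0:ℝ) < ((j + 1 : ℕ) : ℝ) / n := by positivity
    have hs1 : ((j + 1 : ℕ) : ℝ) / n ≤ 1 := by
      rw [div_le_one hn']; exact_mod_cast hj
    have hlt : gradedNode n q j < gradedNode n q (j + 1) := by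
      unfold gradedNode
      apply Real.rpow_lt_rpow (by positivity) _ hq0
      push_cast
      gcongr
      linarith
    have hle1 := htle (j + 1) hj
    have hj0 := htpos j
    have hsub : Set.Ioc (gradedNode n q j) (gradedNode n q (j + 1)) ⊆ Set.Ioc 0 1 :=
      Set.Ioc_subset_Ioc hj0 hle1
    have huj : IntervalIntegrable u volume (gradedNode n q j) (gradedNode n q (j + 1)) :=
      (intervalIntegrable_iff_integrableOn_Ioc_of_le hlt.le).2 (hui.mono_set hsub)
    have osc : ∀ y ∈ Set.Ioc (gradedNode n q j) (gradedNode n q (j + 1)),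
        ∀ z ∈ Set.Ioc (gradedNode n q j) (gradedNode n q (j + 1)), z ≤ y → |u y - u z| ≤
        M / α * (gradedNode n q (j + 1) ^ α - gradedNode n q j ^ α) := by
      intro y hy z hz hzy
      refine (aux_osc_le hα0 hu hM1 (hsub hz).1 hzy (hsub hy).2).trans ?_
      have h1 : y ^ α ≤ gradedNode n q (j + 1) ^ α :=
        Real.rpow_le_rpow (hsub hy).1.le hy.2 hα0.le
      have h2 : gradedNode n q j ^ α ≤ z ^ α := Real.rpow_le_rpow hj0 hz.1.le hα0.le
      gcongr
    have hcell := aux_cell hp0 hp1 hx.1 hj0 hlt huj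
      (E := M / α * (gradedNode n q (j + 1) ^ α - gradedNode n q j ^ α)) (by
        intro y hy z hz
        rcases le_total z y with h | h
        · exact osc y hy z hz h
        · rw [abs_sub_comm]; exact osc z hz y hy h)
    have hcongr : ∀ y ∈ Set.uIoc (gradedNode n q j) (gradedNode n q (j + 1)),
        cornerKernel p x y * (u y - (gradedNode n q (j + 1) - gradedNode n q j)⁻¹ *
          ∫ z in (gradedNode n q j)..(gradedNode n q (j + 1)), u z) =
        cornerKernel p x y * (u y - gradedProj n q u y) := by
      intro y hy
      rw [Set.uIoc_of_le hlt.le] at hy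
      rw [aux_proj_eq hq0 u hj hy]
    refine ⟨hcell.1.congr hcongr, ?_⟩
    rw [← intervalIntegral.integral_congr_ae (Filter.Eventually.of_forall hcongr)]
    refine hcell.2.trans ?_
    have hI : 0 ≤ ∫ y in (gradedNode n q j)..(gradedNode n q (j + 1)), x / (x ^ 2 + y ^ 2) := by
      apply intervalIntegral.integral_nonneg hlt.le
      intro y _
      have := hx.1
      positivity
    apply mul_le_mul_of_nonneg_right _ hI
    rw [← hA, mul_assoc, mul_assoc A, mul_assoc A]
    apply mul_le_mul_of_nonneg_left _ hA0.le
    have hb1 := aux_bernoulli (r := q) (by linarith) hn j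
    have hb2 := aux_bernoulli (r := q * α) (by linarith) hn j
    have e1 : gradedNode n q (j + 1) ^ α = (((j + 1 : ℕ) : ℝ) / n) ^ (q * α) := by
      unfold gradedNode; rw [← Real.rpow_mul hs0.le]
    have e2 : gradedNode n q j ^ α = ((j : ℝ) / n) ^ (q * α) := by
      unfold gradedNode; rw [← Real.rpow_mul (by positivity)]
    have hr1 : (gradedNode n q (j + 1) - gradedNode n q j) / gradedNode n q (j + 1)
        ≤ q / ((j:ℝ) + 1) := by
      rw [div_le_iff₀ (by linarith)]
      exact hb1
    have hr2 : (((j + 1 : ℕ) : ℝ) / n) ^ (q * α) ≤ (((j + 1 : ℕ) : ℝ) / n) ^ 2 := by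
      rw [← Real.rpow_natCast (((j + 1 : ℕ) : ℝ) / n) 2]
      exact Real.rpow_le_rpow_of_exponent_ge hs0 hs1 (by push_cast; linarith)
    rw [e1, e2]
    have hr3 : (((j + 1 : ℕ) : ℝ) / n) ^ (q * α) - ((j : ℝ) / n) ^ (q * α) ≤
        q * α / ((j:ℝ) + 1) * (((j + 1 : ℕ) : ℝ) / n) ^ 2 := by
      refine hb2.trans ?_
      gcongr
    have hr0 : 0 ≤ (((j + 1 : ℕ) : ℝ) / n) ^ (q * α) - ((j : ℝ) / n) ^ (q * α) := by
      rw [← e1, ← e2]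
      have := Real.rpow_le_rpow hj0 hlt.le hα0.le
      linarith
    calc _ ≤ q / ((j:ℝ) + 1) * (M / α * (q * α / ((j:ℝ) + 1) * (((j + 1 : ℕ) : ℝ) / n) ^ 2)) := by
          apply mul_le_mul hr1 _ (by positivity) (by positivity)
          gcongr
      _ = _ := by
          push_cast
          field_simp
  have hsplit : cornerErr p q n u x = ∑ j ∈ Finset.range n,
      ∫ y in (gradedNode n q j)..(gradedNode n q (j + 1)),
        cornerKernel p x y * (u y - gradedProj n q u y) := by
    rw [sum_integral_adjacent_intervals (fun j hj => (cell j hj).1), ht0, htn,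
      intervalIntegral.integral_of_le zero_le_one]
    rfl
  have hcont2 : Continuous fun y : ℝ => x / (x ^ 2 + y ^ 2) := by
    apply continuous_const.div (by fun_prop)
    intro y; have := hx.1; positivity
  rw [hsplit]
  calc _ ≤ ∑ j ∈ Finset.range n, |∫ y in (gradedNode n q j)..(gradedNode n q (j + 1)),
        cornerKernel p x y * (u y - gradedProj n q u y)| := Finset.abs_sum_le_sum_abs _ _
    _ ≤ ∑ j ∈ Finset.range n, A * q ^ 2 * ((n:ℝ) ^ 2)⁻¹ * M *
        ∫ y in (gradedNode n q j)..(gradedNode n q (j + 1)), x / (x ^ 2 + y ^ 2) :=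
        Finset.sum_le_sum fun j hj => (cell j (Finset.mem_range.1 hj)).2
    _ = A * q ^ 2 * ((n:ℝ) ^ 2)⁻¹ * M * ∫ y in (0:ℝ)..1, x / (x ^ 2 + y ^ 2) := by
        rw [← Finset.mul_sum, sum_integral_adjacent_intervals
          (fun j _ => hcont2.intervalIntegrable _ _), ht0, htn]
    _ ≤ A * q ^ 2 * ((n:ℝ) ^ 2)⁻¹ * M * (Real.pi / 2) := by
        gcongr
        exact aux_int_le hx.1
    _ = _ := by ring
end

section
/- Fix p ∈ (0,1), α with 0 < α < 1/(1+p), a grading exponent q > 2/α, and set β = α − 2/q ∈ (0,1). For each n ≥ 1 let π_h be the piecewise-constant mean-value projection on the graded mesh with nodes t_i = (i/n)^q. Then there is a constant C, independent of n and u, such that for every u ∈ C¹_α the function w = K(I − π_h)u satisfies ‖w‖_{1,β} ≤ C·n^{−2}·‖u‖_{1,α}. -/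
open MeasureTheory Real

/-- x-derivative of the corner kernel. -/
noncomputable def cornerKx (p x y : ℝ) : ℝ :=
  Real.sin (p * Real.pi) / Real.pi * (y ^ 2 - x ^ 2) /
    (x ^ 2 + y ^ 2 + 2 * x * y * Real.cos (p * Real.pi)) ^ 2

theorem ker_den (c x y : ℝ) (hc1 : c < 1) :
    (1 + c) / 2 * (x + y) ^ 2 ≤ x ^ 2 + y ^ 2 + 2 * x * y * c := by
  nlinarith [mul_nonneg (sub_nonneg.2 hc1.le) (sq_nonneg (x - y))]

theorem hda_congr {f g : ℝ → ℝ} {a b x : ℝ} (h : HasDerivAt f a x) (hfg : ∀ z, g z = f z)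
    (hab : b = a) : HasDerivAt g b x := by
  have : g = f := funext hfg
  rw [this, hab]; exact h

theorem ker_facts (p : ℝ) (hp0 : 0 < p) (hp1 : p < 1) :
    ∃ A : ℝ, 0 < A ∧
      (∀ x y : ℝ, 0 < x → 0 ≤ y → |cornerKernel p x y| ≤ A * (x / (x + y) ^ 2)) ∧
      (∀ x y : ℝ, 0 < x → 0 ≤ y →
        HasDerivAt (fun x => cornerKernel p x y) (cornerKx p x y) x) ∧
      (∀ x y : ℝ, 0 < x → 0 ≤ y → |cornerKx p x y| ≤ A * (1 / (x + y) ^ 2)) ∧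
      (∀ x y t : ℝ, 0 < x → 0 ≤ y → y ≤ t →
        |cornerKernel p x y - cornerKernel p x t| ≤ A * (1 / (x + y) ^ 2) * (t - y)) ∧
      (∀ x y t : ℝ, 0 < x → 0 ≤ y → y ≤ t →
        |cornerKx p x y - cornerKx p x t| ≤ A * (1 / (x + y) ^ 3) * (t - y)) ∧
      (∀ x : ℝ, 0 < x → ContinuousOn (cornerKernel p x) (Set.Ici 0)) ∧
      (∀ x : ℝ, 0 < x → ContinuousOn (cornerKx p x) (Set.Ici 0)) ∧
      (∀ x T : ℝ, 0 < x → 0 ≤ T →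
        ∫ y in (0:ℝ)..T, cornerKx p x y = -(T * cornerKernel p x T) / x) := by
  have hpi := Real.pi_pos
  have hs : 0 < Real.sin (p * Real.pi) :=
    Real.sin_pos_of_pos_of_lt_pi (by positivity) (by nlinarith)
  have hsc := Real.sin_sq_add_cos_sq (p * Real.pi)
  unfold cornerKx cornerKernel
  set c := Real.cos (p * Real.pi) with hc
  set s := Real.sin (p * Real.pi) / Real.pi with hsdef
  have hs' : 0 < s := by positivity
  have hc1 : c < 1 := by nlinarith
  have hc0 : -1 < c := by nlinarith
  clear_value c s
  set d := (1 + c) / 2 with hd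
  have hd0 : 0 < d := by linarith
  have hd1 : d ≤ 1 := by linarith
  have hcd : c = 2 * d - 1 := by linarith
  have hden : ∀ x y : ℝ, d * (x + y) ^ 2 ≤ x ^ 2 + y ^ 2 + 2 * x * y * c :=
    fun x y => ker_den c x y hc1
  have hup : ∀ x y : ℝ, 0 < x → 0 ≤ y → x ^ 2 + y ^ 2 + 2 * x * y * c ≤ (x + y) ^ 2 := by
    intro x y hx hy
    nlinarith [mul_nonneg hx.le hy]
  have hpos : ∀ x y : ℝ, 0 < x → 0 ≤ y → 0 < x ^ 2 + y ^ 2 + 2 * x * y * c := by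
    intro x y hx hy
    have : 0 < x + y := by linarith
    exact lt_of_lt_of_le (by positivity) (hden x y)
  have hA : 0 < 6 * s / d ^ 3 := by positivity
  have hcab : |c| ≤ 1 := abs_le.2 ⟨by linarith, by linarith⟩
  have hDy : ∀ x y : ℝ, HasDerivAt (fun y => x ^ 2 + y ^ 2 + 2 * x * y * c) (2 * y + 2 * x * c) y := by
    intro x y
    have := (((hasDerivAt_id y).pow 2).const_add (x^2)).add
      (((hasDerivAt_id y).const_mul (2 * x)).mul_const c)
    refine hda_congr this (fun z => by simp) (by simp)
  have hDx : ∀ x y : ℝ, HasDerivAt (fun x => x ^ 2 + y ^ 2 + 2 * x * y * c) (2 * x + 2 * y * c) x := by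
    intro x y
    have := (((hasDerivAt_id x).pow 2).add_const (y^2)).add
      ((((hasDerivAt_id x).const_mul 2).mul_const y).mul_const c)
    refine hda_congr this (fun z => by simp) (by simp)
  -- y derivatives
  have hky : ∀ x y : ℝ, 0 < x → 0 ≤ y →
      HasDerivAt (fun y => s * x / (x ^ 2 + y ^ 2 + 2 * x * y * c))
        (-(s * x * (2 * y + 2 * x * c)) / (x ^ 2 + y ^ 2 + 2 * x * y * c) ^ 2) y := by
    intro x y hx hy
    have := (hasDerivAt_const y (s * x)).div (hDy x y) (hpos x y hx hy).ne'
    refine hda_congr this (fun z => by simp) (by ring)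
  have hkxy : ∀ x y : ℝ, 0 < x → 0 ≤ y →
      HasDerivAt (fun y => s * (y ^ 2 - x ^ 2) / (x ^ 2 + y ^ 2 + 2 * x * y * c) ^ 2)
        (s * (2 * y * (x ^ 2 + y ^ 2 + 2 * x * y * c) - 2 * (y ^ 2 - x ^ 2) * (2 * y + 2 * x * c))
          / (x ^ 2 + y ^ 2 + 2 * x * y * c) ^ 3) y := by
    intro x y hx hy
    have h0 := (hpos x y hx hy).ne'
    have := (((((hasDerivAt_id y).pow 2).sub_const (x ^ 2)).const_mul s)).div
      ((hDy x y).pow 2) (pow_ne_zero 2 h0)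
    refine hda_congr this (fun z => by simp) ?_
    simp
    field_simp
  have hlin : ∀ x y : ℝ, 0 < x → 0 ≤ y → |2 * y + 2 * x * c| ≤ 2 * (x + y) := by
    intro x y hx hy
    rw [abs_le]; constructor <;> nlinarith
  have hsq : ∀ x y : ℝ, 0 < x → 0 ≤ y → |y ^ 2 - x ^ 2| ≤ (x + y) ^ 2 := by
    intro x y hx hy
    rw [abs_le]; constructor <;> nlinarith
  have hd3 : ∀ k : ℕ, k ≤ 3 → 1 / d ^ k ≤ 1 / d ^ 3 := by
    intro k hk
    exact one_div_le_one_div_of_le (by positivity) (pow_le_pow_of_le_one hd0.le hd1 hk)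
  -- generic bound
  have hgen' : ∀ (x y N J : ℝ) (k : ℕ), 0 < x → 0 ≤ y → k ≤ 3 → |N| ≤ 6 * s * J → 
      |N / (x ^ 2 + y ^ 2 + 2 * x * y * c) ^ k| ≤ 6 * s / d ^ 3 * (J / ((x + y) ^ 2) ^ k) := by
    intro x y N J k hx hy hk hNb
    have h1 : 0 < x + y := by linarith
    have hP := hpos x y hx hy
    rw [abs_div, abs_of_pos (pow_pos hP k)]
    have h2 : |N| / (x ^ 2 + y ^ 2 + 2 * x * y * c) ^ k ≤ |N| / (d * (x + y) ^ 2) ^ k := by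
      apply div_le_div_of_nonneg_left (abs_nonneg N) (by positivity)
      exact pow_le_pow_left₀ (by positivity) (hden x y) k
    refine h2.trans ?_
    have h4 : |N| / (d * (x + y) ^ 2) ^ k = |N| * (1 / d ^ k) * (1/ ((x + y) ^ 2) ^ k) := by
      rw [mul_pow]; field_simp
    rw [h4]
    calc |N| * (1 / d ^ k) * (1/ ((x + y) ^ 2) ^ k) ≤ (6 * s * J) * (1 / d ^ 3) * (1/ ((x + y) ^ 2) ^ k) := by
          have h5 := hd3 k hk
          have h6 := (abs_nonneg N).trans hNb
          have h7 : 0 < 1 / d ^ k := by positivity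
          generalize 1 / d ^ k = e1 at *
          generalize he2 : 1 / d ^ 3 = e2 at *
          have : 0 < e2 := by rw [← he2]; positivity
          gcongr
      _ = _ := by ring
  have hkc : ∀ x : ℝ, 0 < x → ContinuousOn (fun y => s * x / (x ^ 2 + y ^ 2 + 2 * x * y * c)) (Set.Ici 0) :=
    fun x hx y hy => (hky x y hx hy).continuousAt.continuousWithinAt
  have hkxc : ∀ x : ℝ, 0 < x → ContinuousOn (fun y => s * (y ^ 2 - x ^ 2) / (x ^ 2 + y ^ 2 + 2 * x * y * c) ^ 2) (Set.Ici 0) :=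
    fun x hx y hy => (hkxy x y hx hy).continuousAt.continuousWithinAt
  refine ⟨6 * s / d ^ 3, hA, ?_, ?_, ?_, ?_, ?_, hkc, hkxc, ?_⟩
  · intro x y hx hy
    have := hgen' x y (s * x) x 1 hx hy (by norm_num) (by rw [abs_of_pos (by positivity)]; nlinarith [mul_pos hs' hx])
    simpa using this
  · intro x y hx hy
    have h0 := (hpos x y hx hy).ne'
    have := (((hasDerivAt_id x).const_mul s)).div (hDx x y) h0
    refine hda_congr this (fun z => by simp) ?_
    simp
    ring
  · intro x y hx hy
    have h1 : 0 < x + y := by linarith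
    have := hgen' x y (s * (y ^ 2 - x ^ 2)) ((x + y) ^ 2) 2 hx hy (by norm_num) (by
      rw [abs_mul, abs_of_pos hs']
      have := hsq x y hx hy
      nlinarith [mul_le_mul_of_nonneg_left this hs'.le, mul_pos hs' (pow_pos h1 2)])
    convert this using 2
    field_simp
  · intro x y t hx hy hyt
    have key := norm_image_sub_le_of_norm_deriv_le_segment' (a := y) (b := t)
      (C := 6 * s / d ^ 3 * (1 / (x + y) ^ 2))
      (fun z hz => (hky x z hx (hy.trans hz.1)).hasDerivWithinAt) (by
      intro z hz
      have hz0 := hy.trans hz.1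
      have h1 : 0 < x + y := by linarith
      have h2 : 0 < x + z := by linarith
      have := hgen' x z (-(s * x * (2 * z + 2 * x * c))) ((x + z) ^ 2) 2 hx hz0 (by norm_num) (by
        rw [abs_neg, abs_mul, abs_of_pos (mul_pos hs' hx)]
        have := hlin x z hx hz0
        calc s * x * |2 * z + 2 * x * c| ≤ s * (x + z) * (2 * (x + z)) := by gcongr; linarith
          _ ≤ _ := by nlinarith [mul_pos hs' (pow_pos h2 2)])
      rw [Real.norm_eq_abs]
      refine this.trans ?_
      have e : (x + z) ^ 2 / ((x + z) ^ 2) ^ 2 = 1 / (x + z) ^ 2 := by field_simp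
      rw [e]
      gcongr
      exact hz.1) t ⟨hyt, le_rfl⟩
    rw [abs_sub_comm]; exact key
  · intro x y t hx hy hyt
    have key := norm_image_sub_le_of_norm_deriv_le_segment' (a := y) (b := t)
      (C := 6 * s / d ^ 3 * (1 / (x + y) ^ 3))
      (fun z hz => (hkxy x z hx (hy.trans hz.1)).hasDerivWithinAt) (by
      intro z hz
      have hz0 := hy.trans hz.1
      have h1 : 0 < x + y := by linarith
      have h2 : 0 < x + z := by linarith
      have := hgen' x z (s * (2 * z * (x ^ 2 + z ^ 2 + 2 * x * z * c) - 2 * (z ^ 2 - x ^ 2) * (2 * z + 2 * x * c))) ((x + z) ^ 3) 3 hx hz0 (by norm_num) (by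
        rw [abs_mul, abs_of_pos hs']
        have a1 := hlin x z hx hz0
        have a2 := hsq x z hx hz0
        have a3 := hup x z hx hz0
        have a4 := (hpos x z hx hz0)
        have b1 : |2 * z * (x ^ 2 + z ^ 2 + 2 * x * z * c)| ≤ 2 * (x + z) * (x + z) ^ 2 := by
          rw [abs_of_nonneg (by positivity)]
          gcongr
          linarith
        have b2 : |2 * (z ^ 2 - x ^ 2) * (2 * z + 2 * x * c)| ≤ 2 * (x + z) ^ 2 * (2 * (x + z)) := by
          rw [abs_mul, abs_mul, abs_two]
          gcongr
        have b3 := abs_sub (2 * z * (x ^ 2 + z ^ 2 + 2 * x * z * c)) (2 * (z ^ 2 - x ^ 2) * (2 * z + 2 * x * c))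
        have b4 : |2 * z * (x ^ 2 + z ^ 2 + 2 * x * z * c) - 2 * (z ^ 2 - x ^ 2) * (2 * z + 2 * x * c)| ≤ 6 * (x + z) ^ 3 := by
          refine b3.trans ?_
          linarith
        nlinarith)
      rw [Real.norm_eq_abs]
      refine this.trans ?_
      have e : (x + z) ^ 3 / ((x + z) ^ 2) ^ 3 = 1 / (x + z) ^ 3 := by field_simp
      rw [e]
      gcongr
      exact hz.1) t ⟨hyt, le_rfl⟩
    rw [abs_sub_comm]; exact key
  · intro x T hx hT
    have := intervalIntegral.integral_eq_sub_of_hasDerivAt (a := 0) (b := T)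
      (f := fun y => -(y * (s * x / (x ^ 2 + y ^ 2 + 2 * x * y * c))) / x)
      (f' := fun y => s * (y ^ 2 - x ^ 2) / (x ^ 2 + y ^ 2 + 2 * x * y * c) ^ 2) (by
        intro y hy
        rw [Set.uIcc_of_le hT] at hy
        have h0 := (hpos x y hx hy.1).ne'
        have := (((hasDerivAt_id y).mul (hky x y hx hy.1)).neg).div_const x
        refine hda_congr this (fun z => by simp) ?_
        simp
        field_simp
        ring)
      (ContinuousOn.intervalIntegrable (by
        rw [Set.uIcc_of_le hT]
        exact (hkxc x hx).mono (fun y hy => hy.1)))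
    rw [this]; simp

/-- Bounds on `u` extracted from the weighted norm. -/
def GoodU (α M : ℝ) (u : ℝ → ℝ) : Prop :=
  0 ≤ M ∧ (∀ t ∈ Set.Ioc (0:ℝ) 1, |u t| ≤ M) ∧
    ∀ t ∈ Set.Ioc (0:ℝ) 1, HasDerivWithinAt u (derivWithin u (Set.Ioc 0 1) t) (Set.Ioc 0 1) t ∧
      |derivWithin u (Set.Ioc 0 1) t| ≤ M * t ^ (α - 1)

theorem GoodU.cont {α M : ℝ} {u : ℝ → ℝ} (h : GoodU α M u) : ContinuousOn u (Set.Ioc 0 1) :=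
  fun t ht => (h.2.2 t ht).1.continuousWithinAt

theorem GoodU.intOn {α M : ℝ} {u : ℝ → ℝ} (h : GoodU α M u) :
    IntegrableOn u (Set.Ioc 0 1) := by
  refine Integrable.of_bound (h.cont.aestronglyMeasurable measurableSet_Ioc) M ?_
  filter_upwards [ae_restrict_mem measurableSet_Ioc] with t ht
  exact h.2.1 t ht

theorem GoodU.mvt {α M : ℝ} {u : ℝ → ℝ} (hα : α < 1) (h : GoodU α M u) (y z : ℝ) (hy : 0 < y)
    (hyz : y ≤ z) (hz : z ≤ 1) : |u z - u y| ≤ M * y ^ (α - 1) * (z - y) := by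
  have hsub : Set.Icc y z ⊆ Set.Ioc 0 1 := fun t ht => ⟨hy.trans_le ht.1, ht.2.trans hz⟩
  have := norm_image_sub_le_of_norm_deriv_le_segment' (a := y) (b := z) (f := u)
    (C := M * y ^ (α - 1)) (fun t ht => (h.2.2 t (hsub ht)).1.mono hsub) (by
      intro t ht
      refine (h.2.2 t (hsub ⟨ht.1, ht.2.le⟩)).2.trans ?_
      have := h.1
      have h2 : t ^ (α - 1) ≤ y ^ (α - 1) :=
        Real.rpow_le_rpow_of_nonpos hy ht.1 (by linarith)
      gcongr) z ⟨hyz, le_rfl⟩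
  exact this

theorem GoodU.holder {α M : ℝ} {u : ℝ → ℝ} (hα : 0 < α) (h : GoodU α M u) (y z : ℝ) (hy : 0 < y)
    (hyz : y ≤ z) (hz : z ≤ 1) : |u z - u y| ≤ M / α * (z ^ α - y ^ α) := by
  have hsub : Set.Icc y z ⊆ Set.Ioc 0 1 := fun t ht => ⟨hy.trans_le ht.1, ht.2.trans hz⟩
  have hcu : ContinuousOn u (Set.Icc y z) := h.cont.mono hsub
  have hcp : ContinuousOn (fun t : ℝ => M / α * t ^ α) (Set.Icc y z) :=
    (continuousOn_id.rpow_const (fun t _ => Or.inr hα.le)).const_smul (M / α)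
  have hdu : ∀ t ∈ interior (Set.Icc y z), HasDerivAt u (derivWithin u (Set.Ioc 0 1) t) t := by
    intro t ht
    rw [interior_Icc] at ht
    exact (h.2.2 t (hsub ⟨ht.1.le, ht.2.le⟩)).1.hasDerivAt
      (Ioc_mem_nhds (hy.trans ht.1) (ht.2.trans_le hz))
  have hdp : ∀ t ∈ interior (Set.Icc y z),
      HasDerivAt (fun t : ℝ => M / α * t ^ α) (M * t ^ (α - 1)) t := by
    intro t ht
    rw [interior_Icc] at ht
    have := (Real.hasDerivAt_rpow_const (x := t) (p := α) (Or.inl (hy.trans ht.1).ne')).const_mul (M / α)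
    have e : M * t ^ (α - 1) = M / α * (α * t ^ (α - 1)) := by field_simp
    rw [e]; exact this
  have hb : ∀ t ∈ interior (Set.Icc y z), |derivWithin u (Set.Ioc 0 1) t| ≤ M * t ^ (α - 1) := by
    intro t ht
    exact (h.2.2 t (hsub (interior_subset ht))).2
  have m1 : MonotoneOn ((fun t : ℝ => M / α * t ^ α) + u) (Set.Icc y z) := by
    apply monotoneOn_of_deriv_nonneg (convex_Icc y z) (hcp.add hcu)
    · intro t ht
      exact ((hdp t ht).add (hdu t ht)).differentiableAt.differentiableWithinAt
    · intro t ht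
      rw [((hdp t ht).add (hdu t ht)).deriv]
      linarith [(abs_le.1 (hb t ht)).1]
  have m2 : MonotoneOn ((fun t : ℝ => M / α * t ^ α) - u) (Set.Icc y z) := by
    apply monotoneOn_of_deriv_nonneg (convex_Icc y z) (hcp.sub hcu)
    · intro t ht
      exact ((hdp t ht).sub (hdu t ht)).differentiableAt.differentiableWithinAt
    · intro t ht
      rw [((hdp t ht).sub (hdu t ht)).deriv]
      linarith [(abs_le.1 (hb t ht)).2]
  have e1 := m1 ⟨le_rfl, hyz⟩ ⟨hyz, le_rfl⟩ hyz
  have e2 := m2 ⟨le_rfl, hyz⟩ ⟨hyz, le_rfl⟩ hyz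
  simp only [Pi.add_apply, Pi.sub_apply] at e1 e2
  rw [abs_le]; constructor <;> linarith

theorem GoodU.lim {α M : ℝ} {u : ℝ → ℝ} (hα : 0 < α) (h : GoodU α M u) :
    ∃ c : ℝ, ∀ y ∈ Set.Ioc (0:ℝ) 1, |u y - c| ≤ M / α * y ^ α := by
  have hMα : 0 ≤ M / α := div_nonneg h.1 hα.le
  obtain ⟨c, hc1, hc2⟩ := exists_between_of_forall_le
    (s := (fun y => u y - M / α * y ^ α) '' Set.Ioc (0:ℝ) 1)
    (t := (fun y => u y + M / α * y ^ α) '' Set.Ioc (0:ℝ) 1)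
    ⟨_, ⟨1, by simp, rfl⟩⟩ ⟨_, ⟨1, by simp, rfl⟩⟩ (by
      rintro _ ⟨y, hy, rfl⟩ _ ⟨z, hz, rfl⟩
      have hyp := mul_nonneg hMα (Real.rpow_nonneg hy.1.le α)
      have hzp := mul_nonneg hMα (Real.rpow_nonneg hz.1.le α)
      rcases le_total y z with hl | hl
      · have := abs_le.1 (h.holder hα y z hy.1 hl hz.2)
        simp only
        linarith [this.1, this.2]
      · have := abs_le.1 (h.holder hα z y hz.1 hl hy.2)
        simp only
        linarith [this.1, this.2])
  refine ⟨c, fun y hy => ?_⟩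
  have a1 := hc1 ⟨y, hy, rfl⟩
  have a2 := hc2 ⟨y, hy, rfl⟩
  simp only at a1 a2
  rw [abs_le]; constructor <;> linarith

theorem mean_dist {u : ℝ → ℝ} {a b c R : ℝ} (hab : a < b) (hu : IntegrableOn u (Set.Ioc a b))
    (hR : ∀ z ∈ Set.Ioc a b, |u z - c| ≤ R) :
    |c - (b - a)⁻¹ * ∫ y in Set.Ioc a b, u y| ≤ R := by
  have hba : 0 < b - a := by linarith
  have h1 : ∫ y in Set.Ioc a b, (u y - c) = (∫ y in Set.Ioc a b, u y) - (b - a) * c := by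
    rw [integral_sub hu (by simp)]
    simp [Measure.real, hab.le]
  have h2 : ‖∫ y in Set.Ioc a b, (u y - c)‖ ≤ R * (b - a) := by
    have := norm_setIntegral_le_of_norm_le_const (μ := volume) (s := Set.Ioc a b) (C := R)
      (f := fun y => u y - c) (by simp) (fun y hy => hR y hy)
    simpa [Measure.real, hab.le] using this
  rw [h1, Real.norm_eq_abs] at h2
  have h3 : c - (b - a)⁻¹ * ∫ y in Set.Ioc a b, u y =
      -((b - a)⁻¹ * ((∫ y in Set.Ioc a b, u y) - (b - a) * c)) := by
    field_simp; ring
  rw [h3, abs_neg, abs_mul, abs_of_pos (inv_pos.2 hba)]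
  calc _ ≤ (b - a)⁻¹ * (R * (b - a)) := by gcongr
    _ = R := by field_simp

theorem mean_zero {u : ℝ → ℝ} {a b : ℝ} (hab : a < b) (hu : IntegrableOn u (Set.Ioc a b)) :
    ∫ z in Set.Ioc a b, (u z - (b - a)⁻¹ * ∫ y in Set.Ioc a b, u y) = 0 := by
  have hba : 0 < b - a := by linarith
  rw [integral_sub hu (integrable_const _)]
  simp [Measure.real, hab.le]
  field_simp
  ring

section mesh
variable {n : ℕ} {q : ℝ}

theorem node_lt (hn : 1 ≤ n) (hq : 0 < q) {i j : ℕ} (hij : i < j) :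
    gradedNode n q i < gradedNode n q j := by
  unfold gradedNode
  have : (0:ℝ) < n := by exact_mod_cast hn
  have : (i:ℝ) < j := by exact_mod_cast hij
  apply Real.rpow_lt_rpow (by positivity) _ hq
  gcongr

theorem node_le (hn : 1 ≤ n) (hq : 0 < q) {i j : ℕ} (hij : i ≤ j) :
    gradedNode n q i ≤ gradedNode n q j := by
  rcases hij.eq_or_lt with h | h
  · rw [h]
  · exact (node_lt hn hq h).le

theorem node_zero (hq : 0 < q) : gradedNode n q 0 = 0 := by
  simp [gradedNode, hq.ne']

theorem node_last (hn : 1 ≤ n) : gradedNode n q n = 1 := by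
  have : (n:ℝ) ≠ 0 := by positivity
  simp [gradedNode, this]

theorem node_nonneg (hn : 1 ≤ n) (hq : 0 < q) (i : ℕ) : 0 ≤ gradedNode n q i := by
  rw [← node_zero (n := n) hq]; exact node_le hn hq (Nat.zero_le i)

theorem node_le_one (hn : 1 ≤ n) (hq : 0 < q) {i : ℕ} (hi : i ≤ n) : gradedNode n q i ≤ 1 := by
  rw [← node_last (q := q) hn]; exact node_le hn hq hi

theorem proj_eq (hn : 1 ≤ n) (hq : 0 < q) (u : ℝ → ℝ) {i : ℕ} (hi : i < n) {y : ℝ}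
    (hy : y ∈ Set.Ioc (gradedNode n q i) (gradedNode n q (i + 1))) :
    gradedProj n q u y = (gradedNode n q (i + 1) - gradedNode n q i)⁻¹ *
        ∫ y in Set.Ioc (gradedNode n q i) (gradedNode n q (i + 1)), u y := by
  unfold gradedProj
  rw [Finset.sum_eq_single (i + 1)]
  · simp [Set.indicator_of_mem hy]
  · intro j hj hji
    apply Set.indicator_of_notMem
    intro hy'
    rw [Finset.mem_Icc] at hj
    rcases lt_or_gt_of_ne hji with h | h
    · have := node_le (q := q) hn hq (show j ≤ i by omega)
      linarith [hy.1, hy'.2]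
    · have := node_le (q := q) hn hq (show i + 1 ≤ j - 1 by omega)
      linarith [hy.2, hy'.1]
  · intro h
    exact absurd (Finset.mem_Icc.2 ⟨by omega, by omega⟩) h

theorem proj_meas (u : ℝ → ℝ) : Measurable (gradedProj n q u) := by
  unfold gradedProj
  apply Finset.measurable_fun_sum
  intro i _
  exact measurable_const.indicator measurableSet_Ioc

theorem exists_cell (hn : 1 ≤ n) (hq : 0 < q) {y : ℝ} (hy : y ∈ Set.Ioc (0:ℝ) 1) :
    ∃ i < n, y ∈ Set.Ioc (gradedNode n q i) (gradedNode n q (i + 1)) := by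
  have hex : ∃ j, y ≤ gradedNode n q j := ⟨n, by rw [node_last hn]; exact hy.2⟩
  classical
  have h1 := Nat.find_spec hex
  have h2 : Nat.find hex ≤ n := Nat.find_min' hex (by rw [node_last hn]; exact hy.2)
  have h3 : Nat.find hex ≠ 0 := by
    intro h0
    rw [h0, node_zero hq] at h1
    linarith [hy.1]
  obtain ⟨i, hi⟩ := Nat.exists_eq_succ_of_ne_zero h3
  refine ⟨i, by omega, ?_, ?_⟩
  · have := Nat.find_min hex (m := i) (by omega)
    exact not_le.1 this
  · rw [hi] at h1; exact h1

theorem cell_sub (hn : 1 ≤ n) (hq : 0 < q) {i : ℕ} (hi : i < n) :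
    Set.Ioc (gradedNode n q i) (gradedNode n q (i + 1)) ⊆ Set.Ioc 0 1 := fun _ ht =>
  ⟨(node_nonneg hn hq i).trans_lt ht.1, ht.2.trans (node_le_one hn hq hi)⟩

theorem err_bdd (hn : 1 ≤ n) (hq : 0 < q) {α M : ℝ} {u : ℝ → ℝ} (h : GoodU α M u) {y : ℝ}
    (hy : y ∈ Set.Ioc (0:ℝ) 1) : |u y - gradedProj n q u y| ≤ 2 * M := by
  obtain ⟨i, hi, hyi⟩ := exists_cell hn hq hy
  rw [proj_eq hn hq u hi hyi]
  apply mean_dist (node_lt hn hq (Nat.lt_succ_self i)) (h.intOn.mono_set (cell_sub hn hq hi))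
  intro z hz
  have a := h.2.1 z (cell_sub hn hq hi hz)
  have b := h.2.1 y hy
  have := abs_sub (u z) (u y)
  linarith

theorem err_meas {α M : ℝ} {u : ℝ → ℝ} (h : GoodU α M u) :
    AEStronglyMeasurable (fun y => u y - gradedProj n q u y) (volume.restrict (Set.Ioc 0 1)) :=
  (h.cont.aestronglyMeasurable measurableSet_Ioc).sub (proj_meas u).aestronglyMeasurable

theorem err_mean (hn : 1 ≤ n) (hq : 0 < q) {α M : ℝ} {u : ℝ → ℝ} (h : GoodU α M u)
    {i : ℕ} (hi : i < n) :
    ∫ y in Set.Ioc (gradedNode n q i) (gradedNode n q (i + 1)), (u y - gradedProj n q u y) = 0 := by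
  rw [← mean_zero (node_lt hn hq (Nat.lt_succ_self i)) (h.intOn.mono_set (cell_sub hn hq hi))]
  apply setIntegral_congr_fun measurableSet_Ioc
  intro y hy
  simp only
  rw [proj_eq hn hq u hi hy]

/-- error near the corner -/
theorem err_first (hn : 1 ≤ n) (hq : 0 < q) {α M : ℝ} {u : ℝ → ℝ} (hα : 0 < α)
    (h : GoodU α M u) :
    ∃ c : ℝ, |c| ≤ M / α * (gradedNode n q 1) ^ α ∧
      ∀ y ∈ Set.Ioc 0 (gradedNode n q 1), |u y - gradedProj n q u y - c| ≤ M / α * y ^ α := by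
  obtain ⟨c, hc⟩ := h.lim hα
  have hMα : 0 ≤ M / α := div_nonneg h.1 hα.le
  have hs := cell_sub (q := q) hn hq (show 0 < n by omega)
  have hlt := node_lt (q := q) hn hq (show 0 < 0 + 1 by omega)
  have hpe := fun y => proj_eq (q := q) hn hq u (show 0 < n by omega) (y := y)
  have hint := h.intOn.mono_set hs
  rw [node_zero hq, zero_add] at *
  refine ⟨c - (gradedNode n q 1 - 0)⁻¹ * ∫ y in Set.Ioc 0 (gradedNode n q 1), u y, ?_, ?_⟩
  · apply mean_dist hlt hint
    intro z hz
    refine (hc z (hs hz)).trans ?_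
    have : z ^ α ≤ gradedNode n q 1 ^ α := Real.rpow_le_rpow hz.1.le hz.2 hα.le
    gcongr
  · intro y hy
    rw [hpe y hy]
    convert hc y (hs hy) using 2
    ring

theorem err_cell (hn : 1 ≤ n) (hq : 1 ≤ q) {α M : ℝ} {u : ℝ → ℝ} (hα : 0 < α) (hα1 : α < 1)
    (h : GoodU α M u) {i : ℕ} (hi1 : 1 ≤ i) (hi : i < n) {y : ℝ}
    (hy : y ∈ Set.Ioc (gradedNode n q i) (gradedNode n q (i + 1))) :
    (gradedNode n q (i + 1) - y) * |u y - gradedProj n q u y| ≤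
      2 ^ q * (q * 2 ^ q) ^ 2 * M * ((n:ℝ) ^ 2)⁻¹ * y ^ (1 + (α - 2 / q)) := by
  have hq0 : 0 < q := by linarith
  have hn0 : (0:ℝ) < n := by exact_mod_cast hn
  set a := gradedNode n q i with ha
  set b := gradedNode n q (i + 1) with hb
  have hi1' : (1:ℝ) ≤ i := by exact_mod_cast hi1
  have hapos : 0 < a := by
    rw [ha, ← node_zero (n := n) hq0]; exact node_lt hn hq0 (by omega)
  have hab : a < b := node_lt hn hq0 (Nat.lt_succ_self i)
  have hypos : 0 < y := hapos.trans hy.1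
  have hb1 : b ≤ 1 := node_le_one hn hq0 hi
  have hsub := cell_sub (q := q) hn hq0 hi
  have h2q : (1:ℝ) ≤ 2 ^ q := Real.one_le_rpow (by norm_num) hq0.le
  -- b ≤ 2^q a
  have hb2 : b ≤ 2 ^ q * a := by
    rw [ha, hb]
    unfold gradedNode
    rw [← Real.mul_rpow (by norm_num) (by positivity)]
    apply Real.rpow_le_rpow (by positivity) _ hq0.le
    push_cast
    rw [← mul_div_assoc]
    gcongr
    linarith
  have hby : b ≤ 2 ^ q * y := hb2.trans (by have := hy.1.le; gcongr)
  -- step size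
  have hL : b - a ≤ q * 2 ^ q * y ^ (1 - 1 / q) / n := by
    have hbern : b - a ≤ q * (((i:ℝ) + 1) / n) ^ (q - 1) * (1 / n) := by
      have := one_add_mul_self_le_rpow_one_add (s := -1 / ((i:ℝ) + 1)) (by
        rw [le_div_iff₀ (by positivity)]; linarith) hq
      have e1 : 1 + -1 / ((i:ℝ) + 1) = (i / n) / (((i:ℝ) + 1) / n) := by field_simp; ring
      rw [e1, Real.div_rpow (by positivity) (by positivity)] at this
      have hB : 0 < (((i:ℝ) + 1) / n) := by positivity
      have hBq := Real.rpow_pos_of_pos hB q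
      rw [le_div_iff₀ hBq] at this
      rw [ha, hb]
      unfold gradedNode
      push_cast
      have e2 : (((i:ℝ) + 1) / n) ^ q = (((i:ℝ) + 1) / n) ^ (q - 1) * (((i:ℝ) + 1) / n) := by
        rw [← Real.rpow_add_one hB.ne']; ring_nf
      have e3 : (1 + q * (-1 / ((i:ℝ) + 1))) * (((i:ℝ) + 1) / n) ^ q =
        (((i:ℝ) + 1) / n) ^ q - q * (((i:ℝ) + 1) / n) ^ (q - 1) * (1 / n) := by
        rw [e2]; field_simp; ring
      linarith
    have e4 : (((i:ℝ) + 1) / n) ^ (q - 1) = b ^ (1 - 1 / q) := by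
      rw [hb]
      unfold gradedNode
      rw [← Real.rpow_mul (by positivity)]
      push_cast
      congr 1
      field_simp
    rw [e4] at hbern
    have hex : 0 ≤ 1 - 1 / q := by
      rw [sub_nonneg, div_le_one hq0]; exact hq
    have e5 : b ^ (1 - 1 / q) ≤ 2 ^ q * y ^ (1 - 1 / q) := by
      calc b ^ (1 - 1 / q) ≤ (2 ^ q * y) ^ (1 - 1 / q) :=
            Real.rpow_le_rpow (hapos.trans hab).le hby hex
        _ = (2 ^ q) ^ (1 - 1 / q) * y ^ (1 - 1 / q) := Real.mul_rpow (by positivity) hypos.le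
        _ ≤ (2 ^ q) ^ (1:ℝ) * y ^ (1 - 1 / q) := by
            gcongr
            have : 0 < 1 / q := by positivity
            linarith
        _ = _ := by rw [Real.rpow_one]
    calc b - a ≤ q * b ^ (1 - 1 / q) * (1 / n) := hbern
      _ ≤ q * (2 ^ q * y ^ (1 - 1 / q)) * (1 / n) := by gcongr
      _ = _ := by ring
  -- error
  have hpow : a ^ (α - 1) ≤ 2 ^ q * y ^ (α - 1) := by
    have h1 : y / 2 ^ q ≤ a := by
      rw [div_le_iff₀ (by positivity)]
      linarith [hy.2]
    calc a ^ (α - 1) ≤ (y / 2 ^ q) ^ (α - 1) :=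
          Real.rpow_le_rpow_of_nonpos (by positivity) h1 (by linarith)
      _ = y ^ (α - 1) * (2 ^ q) ^ (1 - α) := by
          rw [Real.div_rpow hypos.le (by positivity), div_eq_mul_inv,
            ← Real.rpow_neg (by positivity)]
          ring_nf
      _ ≤ y ^ (α - 1) * (2 ^ q) ^ (1:ℝ) := by
          gcongr
          linarith
      _ = _ := by rw [Real.rpow_one]; ring
  have hM := h.1
  have hE : |u y - gradedProj n q u y| ≤ M * (2 ^ q * y ^ (α - 1)) * (b - a) := by
    rw [proj_eq hn hq0 u hi hy]
    apply mean_dist hab (h.intOn.mono_set hsub)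
    intro z hz
    have aux : ∀ s t : ℝ, a < s → s ≤ t → t ≤ b → |u t - u s| ≤ M * (2 ^ q * y ^ (α - 1)) * (b - a) := by
      intro s t hs hst ht
      refine (h.mvt hα1 s t (hapos.trans hs) hst (ht.trans hb1)).trans ?_
      have : s ^ (α - 1) ≤ a ^ (α - 1) :=
        Real.rpow_le_rpow_of_nonpos hapos hs.le (by linarith)
      have h3 := this.trans hpow
      gcongr
    rcases le_total z y with hl | hl
    · rw [abs_sub_comm]; exact aux z y hz.1 hl hy.2
    · exact aux y z hy.1 hl hz.2
  have hba : 0 ≤ b - a := by linarith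
  calc (b - y) * |u y - gradedProj n q u y| ≤ (b - a) * (M * (2 ^ q * y ^ (α - 1)) * (b - a)) := by
        gcongr
        · exact hy.1.le
    _ = M * (2 ^ q * y ^ (α - 1)) * (b - a) ^ 2 := by ring
    _ ≤ M * (2 ^ q * y ^ (α - 1)) * (q * 2 ^ q * y ^ (1 - 1 / q) / n) ^ 2 := by gcongr
    _ = 2 ^ q * (q * 2 ^ q) ^ 2 * M * ((n:ℝ) ^ 2)⁻¹ * (y ^ (α - 1) * (y ^ (1 - 1 / q)) ^ 2) := by
        field_simp
    _ = _ := by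
        congr 1
        rw [← Real.rpow_natCast, ← Real.rpow_mul hypos.le, ← Real.rpow_add hypos]
        congr 1
        push_cast
        ring

end mesh

section estimates

theorem F_cont {x β : ℝ} (hx : 0 < x) (hβ : 0 < β) (s : ℕ) :
    ContinuousOn (fun y : ℝ => y ^ (1 + β) / (x + y) ^ s) (Set.Ici 0) := by
  apply ContinuousOn.div
  · exact continuousOn_id.rpow_const (fun t _ => Or.inr (by linarith))
  · fun_prop
  · intro y hy
    have : 0 < x + y := by have : (0:ℝ) ≤ y := hy; linarith
    positivity

theorem F_ii {x β : ℝ} (hx : 0 < x) (hβ : 0 < β) (s : ℕ) {a b : ℝ} (ha : 0 ≤ a) (hb : 0 ≤ b) :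
    IntervalIntegrable (fun y : ℝ => y ^ (1 + β) / (x + y) ^ s) volume a b := by
  apply ContinuousOn.intervalIntegrable
  refine (F_cont hx hβ s).mono ?_
  intro y hy
  exact (le_min ha hb).trans hy.1

theorem I1 {x β : ℝ} (hx : 0 < x) (hβ : 0 < β) :
    ∫ y in (0:ℝ)..1, y ^ (1 + β) / (x + y) ^ 2 ≤ 1 / β := by
  have h1 : ∫ y in (0:ℝ)..1, y ^ (β - 1) = 1 / β := by
    rw [integral_rpow (Or.inl (by linarith))]
    simp [hβ.ne']
  rw [← h1]
  apply intervalIntegral.integral_mono_on_of_le_Ioo zero_le_one (F_ii hx hβ 2 le_rfl zero_le_one)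
    (intervalIntegral.intervalIntegrable_rpow' (by linarith))
  intro y hy
  have hy0 := hy.1
  have e : y ^ (1 + β) = y ^ (β - 1) * y ^ 2 := by
    rw [← Real.rpow_natCast, ← Real.rpow_add hy0]; congr 1; push_cast; ring
  rw [div_le_iff₀ (by positivity), e]
  gcongr
  linarith

theorem I4_ii {x β : ℝ} (hx : 0 < x) {T : ℝ} (hT : 0 ≤ T) :
    IntervalIntegrable (fun y : ℝ => (x + y) ^ (β - 2)) volume 0 T := by
  apply ContinuousOn.intervalIntegrable
  rw [Set.uIcc_of_le hT]
  apply ContinuousOn.rpow_const (by fun_prop)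
  intro y hy
  left
  linarith [hy.1]

theorem I4 {x β : ℝ} (hx : 0 < x) (hβ1 : β < 1) {T : ℝ} (hT : 0 ≤ T) :
    ∫ y in (0:ℝ)..T, (x + y) ^ (β - 2) ≤ x ^ (β - 1) / (1 - β) := by
  rw [intervalIntegral.integral_eq_sub_of_hasDerivAt
    (f := fun y => (x + y) ^ (β - 1) / (β - 1)) _ (I4_ii hx hT)]
  · have h1 : 0 ≤ (x + T) ^ (β - 1) := Real.rpow_nonneg (by linarith) _
    have h2 : (x + T) ^ (β - 1) / (β - 1) ≤ 0 := div_nonpos_of_nonneg_of_nonpos h1 (by linarith)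
    have h3 : (x + 0) ^ (β - 1) / (β - 1) = - (x ^ (β - 1) / (1 - β)) := by
      rw [add_zero, ← div_neg]; congr 1; ring
    rw [h3]; linarith
  · intro y hy
    rw [Set.uIcc_of_le hT] at hy
    have hp : 0 < x + y := by linarith [hy.1]
    have h1 := (((hasDerivAt_id y).const_add x).rpow_const (p := β - 1) (Or.inl hp.ne')).div_const (β - 1)
    have h0 : β - 1 ≠ 0 := by linarith
    refine hda_congr h1 (fun z => by simp) ?_
    have : β - 1 - 1 = β - 2 := by ring
    rw [this]
    simp only [id]
    rw [one_mul, mul_comm, mul_div_assoc, div_self h0, mul_one]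

theorem pow_split {z β : ℝ} (hz : 0 < z) : z ^ β / z ^ 2 = z ^ (β - 2) := by
  rw [Real.rpow_sub hz]; norm_num

theorem I2 {x β : ℝ} (hx : 0 < x) (hβ : 0 < β) (hβ1 : β < 1) :
    ∫ y in (0:ℝ)..1, y ^ (1 + β) / (x + y) ^ 3 ≤ x ^ (β - 1) / (1 - β) := by
  refine le_trans ?_ (I4 hx hβ1 zero_le_one)
  apply intervalIntegral.integral_mono_on zero_le_one (F_ii hx hβ 3 le_rfl zero_le_one)
    (I4_ii hx zero_le_one)
  intro y hy
  have hp : 0 < x + y := by linarith [hy.1]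
  rw [div_le_iff₀ (by positivity), ← Real.rpow_natCast, ← Real.rpow_add hp]
  have e : β - 2 + ((3:ℕ):ℝ) = 1 + β := by push_cast; ring
  rw [e]
  exact Real.rpow_le_rpow hy.1 (by linarith) (by linarith)

theorem I3_ii {x : ℝ} (hx : 0 < x) {T : ℝ} (hT : 0 ≤ T) :
    IntervalIntegrable (fun y : ℝ => x / (x + y) ^ 2) volume 0 T := by
  apply ContinuousOn.intervalIntegrable
  rw [Set.uIcc_of_le hT]
  apply ContinuousOn.div (by fun_prop) (by fun_prop)
  intro y hy
  have : 0 < x + y := by linarith [hy.1]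
  positivity

theorem I3 {x : ℝ} (hx : 0 < x) {T : ℝ} (hT : 0 ≤ T) :
    ∫ y in (0:ℝ)..T, x / (x + y) ^ 2 ≤ 1 := by
  rw [intervalIntegral.integral_eq_sub_of_hasDerivAt
    (f := fun y => -(x / (x + y))) _ (I3_ii hx hT)]
  · have : 0 ≤ x / (x + T) := by positivity
    have h2 : x / (x + 0) = 1 := by rw [add_zero, div_self hx.ne']
    rw [h2]; linarith
  · intro y hy
    rw [Set.uIcc_of_le hT] at hy
    have hp : 0 < x + y := by linarith [hy.1]
    have h1 := ((hasDerivAt_const y x).div ((hasDerivAt_id y).const_add x) hp.ne').neg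
    exact hda_congr h1 (fun z => by simp) (by simp [neg_div])

variable {n : ℕ} {q : ℝ}

theorem err_ii (hn : 1 ≤ n) (hq : 0 < q) {α M : ℝ} {u : ℝ → ℝ} (h : GoodU α M u)
    {a b : ℝ} (ha : 0 ≤ a) (hab : a ≤ b) (hb : b ≤ 1) :
    IntervalIntegrable (fun y => u y - gradedProj n q u y) volume a b := by
  have h1 : IntegrableOn (fun y => u y - gradedProj n q u y) (Set.Ioc 0 1) := by
    refine Integrable.of_bound (err_meas h) (2 * M) ?_
    filter_upwards [ae_restrict_mem measurableSet_Ioc] with t ht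
    exact err_bdd hn hq h ht
  rw [intervalIntegrable_iff_integrableOn_Ioc_of_le hab]
  exact h1.mono_set (Set.Ioc_subset_Ioc ha hb)

theorem gerr_ii (hn : 1 ≤ n) (hq : 0 < q) {α M : ℝ} {u g : ℝ → ℝ} (h : GoodU α M u)
    (hg : ContinuousOn g (Set.Ici 0))
    {a b : ℝ} (ha : 0 ≤ a) (hab : a ≤ b) (hb : b ≤ 1) :
    IntervalIntegrable (fun y => g y * (u y - gradedProj n q u y)) volume a b := by
  apply (err_ii hn hq h ha hab hb).continuousOn_mul
  rw [Set.uIcc_of_le hab]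
  exact hg.mono (fun y hy => ha.trans hy.1)

theorem tail_bound (hn : 1 ≤ n) (hq : 1 ≤ q) {α M : ℝ} {u g : ℝ → ℝ} (hα : 0 < α) (hα1 : α < 1)
    (hβ : 0 < α - 2 / q)
    (h : GoodU α M u) (hg : ContinuousOn g (Set.Ici 0)) {A x : ℝ} (hA : 0 ≤ A) (hx : 0 < x) (s : ℕ)
    (hgl : ∀ y t : ℝ, 0 ≤ y → y ≤ t → |g y - g t| ≤ A * (1 / (x + y) ^ s) * (t - y))
    (m : ℕ) (hm1 : 1 ≤ m) (hmn : m ≤ n) :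
    |∫ y in (gradedNode n q 1)..(gradedNode n q m), g y * (u y - gradedProj n q u y)| ≤
      A * (2 ^ q * (q * 2 ^ q) ^ 2) * (((n:ℝ) ^ 2)⁻¹ * M) *
        ∫ y in (gradedNode n q 1)..(gradedNode n q m), y ^ (1 + (α - 2 / q)) / (x + y) ^ s := by
  have hq0 : 0 < q := by linarith
  induction m, hm1 using Nat.le_induction with
  | base => simp
  | succ m hm ih =>
    have ih := ih (by omega)
    set a := gradedNode n q m with ha
    set b := gradedNode n q (m + 1) with hb
    have ha0 : 0 ≤ a := node_nonneg hn hq0 m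
    have hab : a < b := node_lt hn hq0 (Nat.lt_succ_self m)
    have hb1 : b ≤ 1 := node_le_one hn hq0 hmn
    have h10 : 0 ≤ gradedNode n q 1 := node_nonneg hn hq0 1
    have h1a : gradedNode n q 1 ≤ a := node_le hn hq0 hm
    have hge := gerr_ii hn hq0 h hg ha0 hab.le hb1
    have he := err_ii hn hq0 h ha0 hab.le hb1
    rw [← intervalIntegral.integral_add_adjacent_intervals
        (gerr_ii hn hq0 h hg h10 h1a (hab.le.trans hb1)) hge,
      ← intervalIntegral.integral_add_adjacent_intervals
        (F_ii hx hβ s h10 ha0) (F_ii hx hβ s ha0 (ha0.trans hab.le)), mul_add]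
    refine (abs_add_le _ _).trans (add_le_add ih ?_)
    have hz : ∫ y in a..b, (u y - gradedProj n q u y) = 0 := by
      rw [intervalIntegral.integral_of_le hab.le]
      exact err_mean hn hq0 h (by omega)
    have e1 : ∫ y in a..b, g y * (u y - gradedProj n q u y) =
        ∫ y in a..b, (g y - g b) * (u y - gradedProj n q u y) := by
      have : ∫ y in a..b, (g y - g b) * (u y - gradedProj n q u y) =
          ∫ y in a..b, (g y * (u y - gradedProj n q u y) - g b * (u y - gradedProj n q u y)) := by
        congr 1; ext y; ring
      rw [this, intervalIntegral.integral_sub hge (he.const_mul _),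
        intervalIntegral.integral_const_mul, hz]
      simp
    rw [e1, ← intervalIntegral.integral_const_mul, ← Real.norm_eq_abs]
    apply intervalIntegral.norm_integral_le_of_norm_le hab.le _
      ((F_ii hx hβ s ha0 (ha0.trans hab.le)).const_mul _)
    refine Filter.Eventually.of_forall fun y hy => ?_
    have hy0 : 0 < y := ha0.trans_lt hy.1
    have c1 := hgl y b hy0.le hy.2
    have c2 := err_cell hn hq hα hα1 h hm (by omega) hy
    rw [Real.norm_eq_abs, abs_mul]
    have hxy : 0 < x + y := by linarith
    calc |g y - g b| * |u y - gradedProj n q u y|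
        ≤ A * (1 / (x + y) ^ s) * (b - y) * |u y - gradedProj n q u y| := by gcongr
      _ = A * (1 / (x + y) ^ s) * ((b - y) * |u y - gradedProj n q u y|) := by ring
      _ ≤ A * (1 / (x + y) ^ s) * (2 ^ q * (q * 2 ^ q) ^ 2 * M * ((n:ℝ) ^ 2)⁻¹ * y ^ (1 + (α - 2 / q))) := by
          gcongr
      _ = _ := by ring

theorem full_bound (hn : 1 ≤ n) (hq : 1 ≤ q) {α M : ℝ} {u g : ℝ → ℝ} (hα : 0 < α) (hα1 : α < 1)
    (hβ : 0 < α - 2 / q)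
    (h : GoodU α M u) (hg : ContinuousOn g (Set.Ici 0)) {A x : ℝ} (hA : 0 ≤ A) (hx : 0 < x) (s : ℕ)
    (hgl : ∀ y t : ℝ, 0 ≤ y → y ≤ t → |g y - g t| ≤ A * (1 / (x + y) ^ s) * (t - y)) {R S : ℝ}
    (hR : |∫ y in (0:ℝ)..(gradedNode n q 1), g y * (u y - gradedProj n q u y)| ≤ R)
    (hS : ∫ y in (0:ℝ)..1, y ^ (1 + (α - 2 / q)) / (x + y) ^ s ≤ S) :
    |∫ y in (0:ℝ)..1, g y * (u y - gradedProj n q u y)| ≤ R +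
      A * (2 ^ q * (q * 2 ^ q) ^ 2) * (((n:ℝ) ^ 2)⁻¹ * M) * S := by
  have hq0 : 0 < q := by linarith
  have h10 : 0 ≤ gradedNode n q 1 := node_nonneg hn hq0 1
  have h11 : gradedNode n q 1 ≤ 1 := node_le_one hn hq0 hn
  have hM := h.1
  have ht := tail_bound hn hq hα hα1 hβ h hg hA hx s hgl n hn le_rfl
  rw [node_last hn] at ht
  rw [← intervalIntegral.integral_add_adjacent_intervals
        (gerr_ii hn hq0 h hg le_rfl h10 h11) (gerr_ii hn hq0 h hg h10 h11 le_rfl)]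
  refine (abs_add_le _ _).trans (add_le_add hR (ht.trans ?_))
  have h0 : 0 ≤ ∫ y in (0:ℝ)..(gradedNode n q 1), y ^ (1 + (α - 2 / q)) / (x + y) ^ s := by
    apply intervalIntegral.integral_nonneg h10
    intro y hy
    have := hy.1
    positivity
  have h2 := intervalIntegral.integral_add_adjacent_intervals
        (F_ii hx hβ s le_rfl h10) (F_ii hx hβ s h10 zero_le_one)
  have h3 : ∫ y in (gradedNode n q 1)..1, y ^ (1 + (α - 2 / q)) / (x + y) ^ s ≤ S := by linarith
  gcongr

theorem t1_pow (hn : 1 ≤ n) (hq : 0 < q) : (gradedNode n q 1) ^ (2 / q) = ((n:ℝ) ^ 2)⁻¹ := by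
  unfold gradedNode
  rw [← Real.rpow_mul (by positivity), mul_div_cancel₀ _ hq.ne']
  norm_num

theorem t1_pos (hn : 1 ≤ n) (hq : 0 < q) : 0 < gradedNode n q 1 := by
  rw [← node_zero (n := n) hq]; exact node_lt hn hq (by norm_num)

theorem y_pow (hn : 1 ≤ n) (hq : 0 < q) {α y : ℝ} (hy : 0 < y) (hy1 : y ≤ gradedNode n q 1) :
    y ^ α ≤ ((n:ℝ) ^ 2)⁻¹ * y ^ (α - 2 / q) := by
  rw [← t1_pow hn hq]
  have e : y ^ α = y ^ (2 / q) * y ^ (α - 2 / q) := by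
    rw [← Real.rpow_add hy]; congr 1; ring
  rw [e]
  gcongr

theorem first_w (hn : 1 ≤ n) (hq : 0 < q) {α M : ℝ} {u g : ℝ → ℝ} (hα : 0 < α)
    (hβ : 0 < α - 2 / q) (h : GoodU α M u) {A x : ℝ} (hA : 0 ≤ A) (hx : 0 < x)
    (hgb : ∀ y : ℝ, 0 ≤ y → |g y| ≤ A * (x / (x + y) ^ 2)) :
    |∫ y in (0:ℝ)..(gradedNode n q 1), g y * (u y - gradedProj n q u y)| ≤
      A * (2 / α) * (((n:ℝ) ^ 2)⁻¹ * M) := by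
  obtain ⟨c, hc1, hc2⟩ := err_first hn hq hα h
  have ht := t1_pos hn hq (n := n)
  have ht1 := node_le_one (q := q) hn hq hn
  have hMα : 0 ≤ M / α := div_nonneg h.1 hα.le
  have hM := h.1
  have hT : gradedNode n q 1 ^ α ≤ ((n:ℝ) ^ 2)⁻¹ := by
    refine (y_pow hn hq ht le_rfl).trans ?_
    have := Real.rpow_le_one ht.le ht1 hβ.le
    exact mul_le_of_le_one_right (by positivity) this
  have key : |∫ y in (0:ℝ)..(gradedNode n q 1), g y * (u y - gradedProj n q u y)| ≤
      ∫ y in (0:ℝ)..(gradedNode n q 1), (A * (2 / α) * (((n:ℝ) ^ 2)⁻¹ * M)) * (x / (x + y) ^ 2) := by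
    rw [← Real.norm_eq_abs]
    apply intervalIntegral.norm_integral_le_of_norm_le ht.le _ ((I3_ii hx ht.le).const_mul _)
    refine Filter.Eventually.of_forall fun y hy => ?_
    have d1 := hc2 y hy
    have d2 : |u y - gradedProj n q u y| ≤ M / α * ((n:ℝ) ^ 2)⁻¹ * 2 := by
      have d3 : |u y - gradedProj n q u y| ≤ |u y - gradedProj n q u y - c| + |c| := by
        have := abs_add_le (u y - gradedProj n q u y - c) c
        simpa using this
      have d4 : y ^ α ≤ gradedNode n q 1 ^ α := Real.rpow_le_rpow hy.1.le hy.2 hα.le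
      have d5 : M / α * y ^ α ≤ M / α * ((n:ℝ) ^ 2)⁻¹ := by gcongr; exact d4.trans hT
      have d6 : M / α * gradedNode n q 1 ^ α ≤ M / α * ((n:ℝ) ^ 2)⁻¹ := by gcongr
      linarith
    have hy0 := hy.1
    rw [Real.norm_eq_abs, abs_mul]
    calc |g y| * |u y - gradedProj n q u y| ≤ (A * (x / (x + y) ^ 2)) * (M / α * ((n:ℝ) ^ 2)⁻¹ * 2) := by
          gcongr
          exact hgb y hy0.le
      _ = _ := by ring
  refine key.trans ?_
  rw [intervalIntegral.integral_const_mul]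
  exact mul_le_of_le_one_right (by positivity) (I3 hx ht.le)

theorem first_w' (hn : 1 ≤ n) (hq : 0 < q) {α M : ℝ} {u g : ℝ → ℝ} (hα : 0 < α) (hα1 : α < 1)
    (hβ : 0 < α - 2 / q) (h : GoodU α M u) {A x k : ℝ} (hA : 0 ≤ A) (hx : 0 < x)
    (hg : ContinuousOn g (Set.Ici 0))
    (hgb : ∀ y : ℝ, 0 ≤ y → |g y| ≤ A * (1 / (x + y) ^ 2))
    (hk : |k| ≤ A * (x / (x + gradedNode n q 1) ^ 2))
    (hgi : ∫ y in (0:ℝ)..(gradedNode n q 1), g y = -(gradedNode n q 1 * k) / x) :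
    |∫ y in (0:ℝ)..(gradedNode n q 1), g y * (u y - gradedProj n q u y)| ≤
      A * (1 / α) * (1 / (1 - (α - 2 / q)) + 1) * (((n:ℝ) ^ 2)⁻¹ * M) * x ^ (α - 2 / q - 1) := by
  obtain ⟨c, hc1, hc2⟩ := err_first hn hq hα h
  have ht := t1_pos hn hq (n := n)
  have ht1 := node_le_one (q := q) hn hq hn
  have hMα : 0 ≤ M / α := div_nonneg h.1 hα.le
  have hM := h.1
  have hβ1 : α - 2 / q < 1 := by
    have : 0 < 2 / q := by positivity
    linarith
  set β := α - 2 / q with hβd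
  set T := gradedNode n q 1 with hTd
  have hgii : IntervalIntegrable g volume 0 T := by
    apply ContinuousOn.intervalIntegrable
    rw [Set.uIcc_of_le ht.le]
    exact hg.mono (fun y hy => hy.1)
  have split : ∫ y in (0:ℝ)..T, g y * (u y - gradedProj n q u y) =
      (∫ y in (0:ℝ)..T, g y * (u y - gradedProj n q u y - c)) + c * (-(T * k) / x) := by
    rw [← hgi, ← intervalIntegral.integral_const_mul, ← intervalIntegral.integral_add]
    · congr 1; ext y; ring
    · have := (gerr_ii hn hq h hg le_rfl ht.le ht1).sub (hgii.const_mul c)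
      refine this.congr ?_
      intro y _
      simp only
      ring
    · exact hgii.const_mul c
  have p1 : |∫ y in (0:ℝ)..T, g y * (u y - gradedProj n q u y - c)| ≤
      A * (1 / α) * (((n:ℝ) ^ 2)⁻¹ * M) * (x ^ (β - 1) / (1 - β)) := by
    have key : |∫ y in (0:ℝ)..T, g y * (u y - gradedProj n q u y - c)| ≤
        ∫ y in (0:ℝ)..T, (A * (1 / α) * (((n:ℝ) ^ 2)⁻¹ * M)) * (x + y) ^ (β - 2) := by
      rw [← Real.norm_eq_abs]
      apply intervalIntegral.norm_integral_le_of_norm_le ht.le _ ((I4_ii hx ht.le).const_mul _)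
      refine Filter.Eventually.of_forall fun y hy => ?_
      have d1 := hc2 y hy
      have hy0 := hy.1
      have hxy : 0 < x + y := by linarith
      have d2 : y ^ α ≤ ((n:ℝ) ^ 2)⁻¹ * (x + y) ^ β := by
        refine (y_pow hn hq hy0 hy.2).trans ?_
        gcongr
        linarith
      rw [Real.norm_eq_abs, abs_mul, ← pow_split hxy]
      calc |g y| * |u y - gradedProj n q u y - c| ≤
            (A * (1 / (x + y) ^ 2)) * (M / α * (((n:ℝ) ^ 2)⁻¹ * (x + y) ^ β)) := by
            gcongr
            · exact hgb y hy0.le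
            · exact d1.trans (by gcongr)
        _ = _ := by ring
    refine key.trans ?_
    rw [intervalIntegral.integral_const_mul]
    gcongr
    exact I4 hx hβ1 ht.le
  have p2 : |c * (-(T * k) / x)| ≤ A * (1 / α) * (((n:ℝ) ^ 2)⁻¹ * M) * x ^ (β - 1) := by
    have hxT : 0 < x + T := by linarith
    rw [abs_mul, abs_div, abs_neg, abs_mul, abs_of_pos ht, abs_of_pos hx]
    have q1 : T ^ α ≤ ((n:ℝ) ^ 2)⁻¹ * (x + T) ^ β := by
      refine (y_pow hn hq ht le_rfl).trans ?_
      gcongr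
      linarith
    have q2 : (x + T) ^ (β - 1) ≤ x ^ (β - 1) :=
      Real.rpow_le_rpow_of_nonpos hx (by linarith) (by linarith)
    have q3 : (x + T) ^ (β - 1) = (x + T) ^ β / (x + T) := Real.rpow_sub_one hxT.ne' _
    calc |c| * (T * |k| / x) ≤ (M / α * (((n:ℝ) ^ 2)⁻¹ * (x + T) ^ β)) *
          ((x + T) * (A * (x / (x + T) ^ 2)) / x) := by
          gcongr
          · exact hc1.trans (by gcongr)
          · linarith
      _ = A * (1 / α) * (((n:ℝ) ^ 2)⁻¹ * M) * (x + T) ^ (β - 1) := by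
          rw [q3]; field_simp
      _ ≤ _ := by gcongr
  rw [split]
  refine (abs_add_le _ _).trans ((add_le_add p1 p2).trans (le_of_eq ?_))
  ring

end estimates

theorem goodU_of (α : ℝ) (hα : 0 < α) (hα1 : α < 1) (u : ℝ → ℝ)
    (hu : ContDiffOn ℝ 1 u (Set.Ioc 0 1)) (hb : BddAbove (weightedSet 1 α u)) :
    GoodU α (weightedNorm 1 α u) u := by
  have hle : ∀ r ∈ weightedSet 1 α u, r ≤ weightedNorm 1 α u := fun r hr => le_csSup hb hr
  have h0 : ∀ t ∈ Set.Ioc (0:ℝ) 1, |u t| ≤ weightedNorm 1 α u := by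
    intro t ht
    apply hle
    refine ⟨0, by norm_num, t, ht, ?_⟩
    rw [iteratedDerivWithin_zero, max_eq_right (by push_cast; linarith), Real.rpow_zero, one_mul]
  refine ⟨(abs_nonneg _).trans (h0 1 (by simp)), h0, ?_⟩
  intro t ht
  refine ⟨((hu.differentiableOn (by norm_num)) t ht).hasDerivWithinAt, ?_⟩
  have := hle _ ⟨1, le_rfl, t, ht, rfl⟩
  rw [iteratedDerivWithin_one, max_eq_left (by push_cast; linarith)] at this
  push_cast at this
  have hp : 0 < t ^ (1 - α) := Real.rpow_pos_of_pos ht.1 _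
  have e : t ^ (α - 1) = (t ^ (1 - α))⁻¹ := by
    rw [← Real.rpow_neg ht.1.le]; congr 1; ring
  rw [e, ← div_eq_mul_inv, le_div_iff₀ hp]
  linarith

theorem cornerErr_hasDeriv {p q : ℝ} {n : ℕ} (hn : 1 ≤ n) (hq : 0 < q) {α M A : ℝ} {u : ℝ → ℝ}
    (h : GoodU α M u) (hA : 0 < A)
    (hd : ∀ x y : ℝ, 0 < x → 0 ≤ y →
        HasDerivAt (fun x => cornerKernel p x y) (cornerKx p x y) x)
    (hb : ∀ x y : ℝ, 0 < x → 0 ≤ y → |cornerKx p x y| ≤ A * (1 / (x + y) ^ 2))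
    (hc : ∀ x : ℝ, 0 < x → ContinuousOn (cornerKernel p x) (Set.Ici 0))
    (hc' : ∀ x : ℝ, 0 < x → ContinuousOn (cornerKx p x) (Set.Ici 0)) {x : ℝ} (hx : 0 < x) :
    HasDerivAt (cornerErr p q n u)
      (∫ y in (0:ℝ)..1, cornerKx p x y * (u y - gradedProj n q u y)) x := by
  rw [intervalIntegral.integral_of_le zero_le_one]
  have hsub : Set.Ioc (0:ℝ) 1 ⊆ Set.Ici 0 := fun y hy => hy.1.le
  have hM := h.1
  refine (hasDerivAt_integral_of_dominated_loc_of_deriv_le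
    (F := fun x y => cornerKernel p x y * (u y - gradedProj n q u y))
    (F' := fun x y => cornerKx p x y * (u y - gradedProj n q u y))
    (bound := fun _ => A * (1 / (x / 2) ^ 2) * (2 * M))
    (s := Set.Ioi (x / 2)) (Ioi_mem_nhds (by linarith)) ?_ ?_ ?_ ?_ ?_ ?_).2
  · filter_upwards [Ioi_mem_nhds hx] with z hz
    exact (((hc z hz).mono hsub).aestronglyMeasurable measurableSet_Ioc).mul (err_meas h)
  · have := gerr_ii hn hq h (hc x hx) le_rfl zero_le_one le_rfl
    rwa [intervalIntegrable_iff_integrableOn_Ioc_of_le zero_le_one] at this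
  · exact (((hc' x hx).mono hsub).aestronglyMeasurable measurableSet_Ioc).mul (err_meas h)
  · filter_upwards [ae_restrict_mem measurableSet_Ioc] with y hy z hz
    have hz' : x / 2 < z := hz
    have hz0 : 0 < z := by linarith
    have hy0 := hy.1
    rw [Real.norm_eq_abs, abs_mul]
    have h1 := err_bdd hn hq h hy
    have h2 := hb z y hz0 hy0.le
    refine mul_le_mul (h2.trans ?_) h1 (abs_nonneg _) (by positivity)
    gcongr
    linarith
  · exact integrable_const _
  · filter_upwards [ae_restrict_mem measurableSet_Ioc] with y hy z hz
    have hz' : x / 2 < z := hz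
    exact (hd z y (by linarith) hy.1.le).mul_const _

/-- For `p ∈ (0,1)`, `0 < α < 1/(1+p)`, grading exponent `q > 2/α` and `β = α − 2/q`,
there is a constant `C > 0`, independent of `n` and `u`, such that for every `u ∈ C¹_α`
the function `w = K(I − π_h)u` satisfies `‖w‖_{1,β} ≤ C·n⁻²·‖u‖_{1,α}`. -/
theorem cornerErr_weighted_bound (p α q : ℝ)
    (hp0 : 0 < p) (hp1 : p < 1) (hα0 : 0 < α) (hα1 : α < 1 / (1 + p))
    (hq : q > 2 / α) :
    ∃ C : ℝ, 0 < C ∧ ∀ n : ℕ, 1 ≤ n → ∀ u : ℝ → ℝ,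
      ContDiffOn ℝ 1 u (Set.Ioc 0 1) → BddAbove (weightedSet 1 α u) →
      BddAbove (weightedSet 1 (α - 2 / q) (cornerErr p q n u)) ∧
      weightedNorm 1 (α - 2 / q) (cornerErr p q n u) ≤
        C * ((n : ℝ) ^ 2)⁻¹ * weightedNorm 1 α u := by
  have hα1' : α < 1 := hα1.trans (by rw [div_lt_one (by linarith)]; linarith)
  have hq2 : 2 < q := by
    have : 2 < 2 / α := by rw [lt_div_iff₀ hα0]; linarith
    linarith
  have hq0 : 0 < q := by linarith
  have hq1 : 1 ≤ q := by linarith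
  have hβ : 0 < α - 2 / q := by
    have h1 : 2 < q * α := by rwa [gt_iff_lt, div_lt_iff₀ hα0] at hq
    rw [sub_pos, div_lt_iff₀ hq0]; linarith
  have hβ1 : α - 2 / q < 1 := by
    have : 0 < 2 / q := by positivity
    linarith
  obtain ⟨A, hA, hk1, hk2, hk3, hk4, hk5, hk6, hk7, hk8⟩ := ker_facts p hp0 hp1
  set B : ℝ := 2 ^ q * (q * 2 ^ q) ^ 2 with hB
  have hB0 : 0 < B := by positivity
  have hb' : 0 < 1 - (α - 2 / q) := by linarith
  set C1 : ℝ := A * (2 / α) + A * B * (1 / (α - 2 / q)) with hC1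
  set C2 : ℝ := A * (1 / α) * (1 / (1 - (α - 2 / q)) + 1) + A * B * (1 / (1 - (α - 2 / q))) with hC2
  have hC1p : 0 < C1 := by positivity
  have hC2p : 0 < C2 := by positivity
  refine ⟨C1 + C2, by positivity, ?_⟩
  intro n hn u hu hbd
  have hG := goodU_of α hα0 hα1' u hu hbd
  set M := weightedNorm 1 α u with hMdef
  have hM := hG.1
  have hn0 : 0 ≤ ((n:ℝ) ^ 2)⁻¹ * M := by positivity
  have w0 : ∀ x ∈ Set.Ioc (0:ℝ) 1, |cornerErr p q n u x| ≤ C1 * (((n:ℝ) ^ 2)⁻¹ * M) := by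
    intro x hx
    have f1 := first_w (g := cornerKernel p x) hn hq0 hα0 hβ hG hA.le hx.1
      (fun y hy => hk1 x y hx.1 hy)
    have f2 := full_bound hn hq1 hα0 hα1' hβ hG (hk6 x hx.1) hA.le hx.1 2
      (fun y t hy hyt => hk4 x y t hx.1 hy hyt) f1 (I1 hx.1 hβ)
    rw [intervalIntegral.integral_of_le zero_le_one] at f2
    unfold cornerErr cornerOp
    refine f2.trans (le_of_eq ?_)
    rw [hC1, hB]; ring
  have w1 : ∀ x ∈ Set.Ioc (0:ℝ) 1, |derivWithin (cornerErr p q n u) (Set.Ioc 0 1) x| ≤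
      C2 * (((n:ℝ) ^ 2)⁻¹ * M) * x ^ (α - 2 / q - 1) := by
    intro x hx
    have hder := cornerErr_hasDeriv hn hq0 hG hA hk2 hk3 hk6 hk7 hx.1
    rw [hder.hasDerivWithinAt.derivWithin (uniqueDiffOn_Ioc 0 1 x hx)]
    have ht := t1_pos (n := n) hn hq0
    have f1 := first_w' (g := cornerKx p x) hn hq0 hα0 hα1' hβ hG hA.le hx.1 (hk7 x hx.1)
      (fun y hy => hk3 x y hx.1 hy) (hk1 x _ hx.1 ht.le) (hk8 x _ hx.1 ht.le)
    have f2 := full_bound hn hq1 hα0 hα1' hβ hG (hk7 x hx.1) hA.le hx.1 3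
      (fun y t hy hyt => hk5 x y t hx.1 hy hyt) f1 (I2 hx.1 hβ hβ1)
    refine f2.trans (le_of_eq ?_)
    rw [hC2, hB]; ring
  have hall : ∀ r ∈ weightedSet 1 (α - 2 / q) (cornerErr p q n u),
      r ≤ (C1 + C2) * ((n : ℝ) ^ 2)⁻¹ * M := by
    rintro r ⟨i, hi, t, ht, rfl⟩
    have hsum : (C1 + C2) * ((n : ℝ) ^ 2)⁻¹ * M = C1 * (((n:ℝ) ^ 2)⁻¹ * M) + C2 * (((n:ℝ) ^ 2)⁻¹ * M) := by
      ring
    have z1 : 0 ≤ C1 * (((n:ℝ) ^ 2)⁻¹ * M) := by positivity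
    have z2 : 0 ≤ C2 * (((n:ℝ) ^ 2)⁻¹ * M) := by positivity
    rw [hsum]
    interval_cases i
    · rw [iteratedDerivWithin_zero, max_eq_right (by push_cast; linarith), Real.rpow_zero, one_mul]
      linarith [w0 t ht]
    · rw [iteratedDerivWithin_one, max_eq_left (by push_cast; linarith)]
      push_cast
      have hp : 0 ≤ t ^ (1 - (α - 2 / q)) := Real.rpow_nonneg ht.1.le _
      have e : t ^ (1 - (α - 2 / q)) * t ^ (α - 2 / q - 1) = 1 := by
        rw [← Real.rpow_add ht.1]
        have : 1 - (α - 2 / q) + (α - 2 / q - 1) = 0 := by ring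
        rw [this, Real.rpow_zero]
      have := mul_le_mul_of_nonneg_left (w1 t ht) hp
      have e2 : t ^ (1 - (α - 2 / q)) * (C2 * (((n:ℝ) ^ 2)⁻¹ * M) * t ^ (α - 2 / q - 1)) =
          C2 * (((n:ℝ) ^ 2)⁻¹ * M) := by
        rw [mul_comm, mul_assoc, mul_comm (t ^ _) (t ^ _), e, mul_one]
      linarith
  refine ⟨⟨_, hall⟩, ?_⟩
  apply csSup_le _ hall
  exact ⟨_, 0, by norm_num, 1, by simp, rfl⟩
end
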